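/- arXiv:1607.03046 — 3 statements merged into one kernel-verified Lean document; each statement's English description precedes it below -/
import Mathlib

section
/- For all n ≥ 1, the number of rooted labeled forests on [n] avoiding all three patterns 132, 231, and 321 equals ∑_{k=1}^{n} B(k)·c(n,k), and the number of rooted labeled forests on [n] avoiding all three patterns 132, 231, and 123 equals ∑_{k=1}^{n} k!·S(n,k), where B(k) is the k-th Bell number, c(n,k) is the unsigned Stirling number of the first kind, and S(n,k) is the Stirling number of the second kind. -/
/-- A rooted labeled forest on `[n]`, encoded as a parent function
`p : Fin n → Option (Fin n)` (`p v = none` means `v` is a root).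
Acyclicity is expressed by the existence of a depth function strictly
decreasing from each vertex to its parent. -/
def IsForest {n : ℕ} (p : Fin n → Option (Fin n)) : Prop :=
  ∃ d : Fin n → ℕ, ∀ v w : Fin n, p v = some w → d w < d v

/-- `StrictAnc p a b` means `a` is a strict ancestor of `b` in the forest `p`. -/
def StrictAnc {n : ℕ} (p : Fin n → Option (Fin n)) (a b : Fin n) : Prop :=
  Relation.TransGen (fun x y : Fin n => p y = some x) a b

/-- The forest `p` contains the pattern `σ` (given in one-line notation):
there is a chain of vertices along some root-to-vertex path whose labels
are order-isomorphic to `σ`. -/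
def ForestContains {n : ℕ} (p : Fin n → Option (Fin n)) (σ : List ℕ) : Prop :=
  ∃ u : Fin σ.length → Fin n,
    (∀ i j : Fin σ.length, i < j → StrictAnc p (u i) (u j)) ∧
    (∀ i j : Fin σ.length, σ.get i < σ.get j ↔ u i < u j)

/-- The forest `p` avoids the pattern `σ`. -/
def ForestAvoids {n : ℕ} (p : Fin n → Option (Fin n)) (σ : List ℕ) : Prop :=
  ¬ ForestContains p σ

/-- Number of cycles (including fixed points) in the cycle decomposition of a
permutation. -/
def permNumCycles {n : ℕ} (π : Equiv.Perm (Fin n)) : ℕ :=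
  π.cycleType.card + (Finset.univ.filter fun x => π x = x).card

/-- Unsigned Stirling number of the first kind: the number of permutations of
`[n]` with exactly `k` cycles. -/
noncomputable def stirlingFirst (n k : ℕ) : ℕ :=
  Nat.card {π : Equiv.Perm (Fin n) // permNumCycles π = k}

/-- Stirling number of the second kind: the number of partitions of `[n]`
into `k` nonempty subsets. -/
noncomputable def stirlingSecond (n k : ℕ) : ℕ :=
  Nat.card {P : Finpartition (Finset.univ : Finset (Fin n)) // P.parts.card = k}

/-- The Bell number: the number of set partitions of `[n]`. -/
noncomputable def bellNumber (n : ℕ) : ℕ :=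
  Nat.card (Finpartition (Finset.univ : Finset (Fin n)))

/-- A vertex is a top-down maximum if it is larger than all of its ancestors. -/
def IsTopDownMax {n : ℕ} (p : Fin n → Option (Fin n)) (v : Fin n) : Prop :=
  ∀ u : Fin n, StrictAnc p u v → u < v

open Finset

theorem forestContains_of_chain {n : ℕ} {p : Fin n → Option (Fin n)} {u w v : Fin n} {a b c : ℕ}
    (hw : p w = some u) (hv : p v = some w) (hab : a < b ↔ u < w) (hba : b < a ↔ w < u)
    (hac : a < c ↔ u < v) (hca : c < a ↔ v < u) (hbc : b < c ↔ w < v) (hcb : c < b ↔ v < w) :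
    ForestContains p [a, b, c] := by
  have h1 : StrictAnc p u w := .single hw
  have h2 : StrictAnc p w v := .single hv
  have h3 : StrictAnc p u v := h1.trans h2
  have h : ∀ i j : Fin 3, i < j → StrictAnc p (![u, w, v] i) (![u, w, v] j) := by
    simp [Fin.forall_fin_succ, h1, h2, h3]
  refine ⟨![u, w, v], h, fun i j => ?_⟩
  fin_cases i <;> fin_cases j <;> simp [*]

theorem StrictAnc.parent_ne_none {n : ℕ} {p : Fin n → Option (Fin n)} {a b : Fin n}
    (h : StrictAnc p a b) : p b ≠ none := by
  cases h with
  | single h => simp [h]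
  | tail _ h => simp [h]

theorem StrictAnc.exists_child {n : ℕ} {p : Fin n → Option (Fin n)} {a b : Fin n}
    (h : StrictAnc p a b) : ∃ c, p c = some a := by
  obtain ⟨c, hc, -⟩ := Relation.TransGen.head'_iff.1 h
  exact ⟨c, hc⟩

theorem isForest_and_avoids_132_231_321_iff {n : ℕ} (p : Fin n → Option (Fin n)) :
    (IsForest p ∧ ForestAvoids p [1, 3, 2] ∧ ForestAvoids p [2, 3, 1] ∧
      ForestAvoids p [3, 2, 1]) ↔ ∀ v w, p v = some w → p w = none ∨ w < v := by
  constructor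
  · rintro ⟨⟨d, hd⟩, h132, h231, h321⟩ v w hv
    by_contra! ⟨hne, hvw⟩
    obtain ⟨u, hu⟩ := Option.ne_none_iff_exists'.1 hne
    have h1 := hd _ _ hv
    have h2 := hd _ _ hu
    have hvw' : v < w := lt_of_le_of_ne hvw (by rintro rfl; omega)
    have huw : u ≠ w := by rintro rfl; omega
    have huv : u ≠ v := by rintro rfl; omega
    rcases lt_or_gt_of_ne huv with h | h
    · exact h132 (forestContains_of_chain hu hv (by omega) (by omega) (by omega) (by omega)
        (by omega) (by omega))
    rcases lt_or_gt_of_ne huw with h' | h'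
    · exact h231 (forestContains_of_chain hu hv (by omega) (by omega) (by omega) (by omega)
        (by omega) (by omega))
    · exact h321 (forestContains_of_chain hu hv (by omega) (by omega) (by omega) (by omega)
        (by omega) (by omega))
  · intro h
    have key : ∀ a b c, StrictAnc p a b → StrictAnc p b c → b < c := by
      intro a b c hab hbc
      have hb := hab.parent_ne_none
      induction hbc with
      | single hc => exact (h _ _ hc).resolve_left hb
      | tail hbc hc ih => exact ih.trans ((h _ _ hc).resolve_left (StrictAnc.parent_ne_none hbc))
    refine ⟨⟨fun v => if p v = none then 0 else v + 1, fun v w hv => ?_⟩, ?_, ?_, ?_⟩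
    · rcases h v w hv with h | h
      · simp [h, hv]
      · simp only [hv]
        split_ifs <;> simp_all
    all_goals
      rintro ⟨u, hu, ho⟩
      exact lt_asymm (key _ _ _ (hu 0 1 (by decide)) (hu 1 2 (by decide)))
        ((ho 2 1).1 (by decide))

theorem isForest_and_avoids_132_231_123_iff {n : ℕ} (p : Fin n → Option (Fin n)) :
    (IsForest p ∧ ForestAvoids p [1, 3, 2] ∧ ForestAvoids p [2, 3, 1] ∧
      ForestAvoids p [1, 2, 3]) ↔ ∀ v w, p v = some w → ∀ u, p w = some u → w < u := by
  constructor
  · rintro ⟨⟨d, hd⟩, h132, h231, h123⟩ v w hv u hu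
    by_contra! hvw
    have h1 := hd _ _ hv
    have h2 := hd _ _ hu
    have huw : u < w := lt_of_le_of_ne hvw (by rintro rfl; omega)
    have hvw : v ≠ w := by rintro rfl; omega
    have huv : u ≠ v := by rintro rfl; omega
    rcases lt_or_gt_of_ne hvw with h | h
    · rcases lt_or_gt_of_ne huv with h' | h'
      · exact h132 (forestContains_of_chain hu hv (by omega) (by omega) (by omega) (by omega)
          (by omega) (by omega))
      · exact h231 (forestContains_of_chain hu hv (by omega) (by omega) (by omega) (by omega)
          (by omega) (by omega))
    · exact h123 (forestContains_of_chain hu hv (by omega) (by omega) (by omega) (by omega)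
        (by omega) (by omega))
  · intro h
    have key : ∀ a b, StrictAnc p a b → ∀ c, p c = some b → b < a := by
      intro a b hab
      induction hab with
      | single hb => exact fun c hc => h _ _ hc _ hb
      | tail _ hb ih => exact fun c hc => (h _ _ hc _ hb).trans (ih _ hb)
    refine ⟨⟨fun v => if ∀ u, p v = some u → v < u then n - v else n + 1,
      fun v w hv => ?_⟩, ?_, ?_, ?_⟩
    · simp only [if_pos (h v w hv)]
      split_ifs with hc
      · have := hc w hv
        omega
      · omega
    all_goals
      rintro ⟨u, hu, ho⟩
      obtain ⟨c, hc⟩ := (hu 1 2 (by decide)).exists_child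
      exact lt_asymm (key _ _ (hu 0 1 (by decide)) c hc) ((ho 0 1).1 (by decide))

theorem prod_add_card_filter_lt {α : Type*} [LinearOrder α] (k : ℕ) (s : Finset α) :
    ∏ v ∈ s, (k + #{w ∈ s | w < v}) = k.ascFactorial #s := by
  induction s using Finset.induction_on_max with
  | empty => simp
  | insert a s ha ih =>
    have hn : a ∉ s := fun h => lt_irrefl _ (ha a h)
    rw [prod_insert hn, card_insert_of_notMem hn, Nat.ascFactorial_succ, ← ih]
    congr 1
    · rw [filter_insert, if_neg (lt_irrefl a), filter_true_of_mem ha]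
    · refine prod_congr rfl fun v hv => ?_
      rw [filter_insert, if_neg (ha v hv).not_gt]

theorem prod_card_filter_gt_add_one {α : Type*} [LinearOrder α] (s : Finset α) :
    ∏ v ∈ s, (#{w ∈ s | v < w} + 1) = (#s).factorial := by
  induction s using Finset.induction_on_min with
  | empty => simp
  | insert a s ha ih =>
    have hn : a ∉ s := fun h => lt_irrefl _ (ha a h)
    rw [prod_insert hn, card_insert_of_notMem hn, Nat.factorial_succ, ← ih]
    congr 1
    · rw [filter_insert, if_neg (lt_irrefl a), filter_true_of_mem ha]
    · refine prod_congr rfl fun v hv => ?_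
      rw [filter_insert, if_neg (ha v hv).not_gt]

/-- Summing over the possible sets of block minima counts the partitions of `s` into `k` blocks:
each remaining element joins the block of a smaller minimum. -/
theorem sum_powersetCard_prod_card_filter_lt {α : Type*} [LinearOrder α] (s : Finset α) (k : ℕ) :
    ∑ C ∈ powersetCard k s, ∏ v ∈ s \ C, #{c ∈ C | c < v} = Nat.stirlingSecond #s k := by
  induction s using Finset.induction_on_max generalizing k with
  | empty =>
    cases k with
    | zero => simp
    | succ k => simp
  | insert a s ha ih =>
    have hn : a ∉ s := fun h => lt_irrefl _ (ha a h)
    rw [card_insert_of_notMem hn]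
    cases k with
    | zero => simp
    | succ k =>
      rw [powersetCard_succ_insert hn, sum_union, Nat.stirlingSecond_succ_succ, ← ih, ← ih,
        mul_sum, sum_image]
      · congr 1
        · refine sum_congr rfl fun C hC => ?_
          obtain ⟨hCs, hCk⟩ := mem_powersetCard.1 hC
          rw [insert_sdiff_of_notMem _ (fun h => hn (hCs h)), prod_insert (by simp [hn]),
            filter_true_of_mem (fun c hc => ha c (hCs hc)), hCk]
        · refine sum_congr rfl fun C hC => ?_
          obtain ⟨hCs, hCk⟩ := mem_powersetCard.1 hC
          rw [insert_sdiff_insert, sdiff_insert_of_notMem hn]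
          refine prod_congr rfl fun v hv => ?_
          rw [filter_insert, if_neg (ha v (mem_sdiff.1 hv).1).not_gt]
      · intro C hC D hD h
        have hC' : a ∉ C := fun h => hn ((mem_powersetCard.1 hC).1 h)
        have hD' : a ∉ D := fun h => hn ((mem_powersetCard.1 hD).1 h)
        simpa [erase_insert, hC', hD'] using congrArg (erase · a) h
      · rw [disjoint_left]
        intro C hC hC'
        obtain ⟨D, -, rfl⟩ := mem_image.1 hC'
        exact hn ((mem_powersetCard.1 hC).1 (mem_insert_self _ _))

theorem sum_stirlingFirst_mul_stirlingSecond (n j : ℕ) :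
    ∑ k ∈ range (n + 1), Nat.stirlingFirst n k * Nat.stirlingSecond k j =
      n.choose j * j.ascFactorial (n - j) := by
  induction n generalizing j with
  | zero => cases j <;> simp
  | succ n ih =>
    rw [sum_range_succ']
    cases j with
    | zero => simp [Nat.zero_ascFactorial]
    | succ j =>
      have h1 : ∑ k ∈ range (n + 1), Nat.stirlingFirst n (k + 1) *
          Nat.stirlingSecond (k + 1) (j + 1) = n.choose (j + 1) * (j + 1).ascFactorial (n - (j + 1))
          := by
        have h := sum_range_succ' (fun k => Nat.stirlingFirst n k * Nat.stirlingSecond k (j + 1))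
          (n + 1)
        rw [sum_range_succ, Nat.stirlingFirst_eq_zero_of_lt n.lt_succ_self] at h
        simpa [← ih] using h.symm
      have h2 : ∑ k ∈ range (n + 1), Nat.stirlingFirst n k *
          Nat.stirlingSecond (k + 1) (j + 1) =
          (j + 1) * (n.choose (j + 1) * (j + 1).ascFactorial (n - (j + 1))) +
          n.choose j * j.ascFactorial (n - j) := by
        rw [← ih, ← ih, mul_sum, ← sum_add_distrib]
        refine sum_congr rfl fun k _ => ?_
        rw [Nat.stirlingSecond_succ_succ]
        ring
      have h3 : ∑ k ∈ range (n + 1), Nat.stirlingFirst (n + 1) (k + 1) *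
          Nat.stirlingSecond (k + 1) (j + 1) =
          n * (n.choose (j + 1) * (j + 1).ascFactorial (n - (j + 1))) +
          ((j + 1) * (n.choose (j + 1) * (j + 1).ascFactorial (n - (j + 1))) +
          n.choose j * j.ascFactorial (n - j)) := by
        rw [← h2, ← h1, mul_sum, ← sum_add_distrib]
        refine sum_congr rfl fun k _ => ?_
        rw [Nat.stirlingFirst_succ_succ]
        ring
      rw [h3]
      rcases lt_trichotomy n j with h | rfl | h
      · simp [Nat.choose_eq_zero_of_lt, h, Nat.lt_succ_of_lt h]
      · simp
      · obtain ⟨d, rfl⟩ := Nat.exists_eq_add_of_lt h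
        have e1 : j + d + 1 - (j + 1) = d := by omega
        have e2 : j + d + 1 - j = d + 1 := by omega
        have e3 : j + d + 1 + 1 - (j + 1) = d + 1 := by omega
        have e4 : j.ascFactorial (d + 1) = j * (j + 1).ascFactorial d :=
          (Nat.succ_ascFactorial j d).symm
        have e5 := Nat.choose_succ_right_eq (j + d + 1) j
        rw [e2] at e5
        rw [e1, e2, e3, e4, Nat.ascFactorial_succ, Nat.choose_succ_succ (j + d + 1) j]
        simp only [Nat.stirlingFirst_succ_zero, zero_mul, add_zero]
        linear_combination (j + 1).ascFactorial d * e5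

/-- A map sending each element to the minimum of its block, for some partition into blocks. -/
def IsMinMap {n : ℕ} (m : Fin n → Fin n) : Prop :=
  ∀ v, m v ≤ v ∧ m (m v) = m v

open Classical in
theorem card_isMinMap_fixedPoints_eq {n : ℕ} (C : Finset (Fin n)) :
    #{m : Fin n → Fin n | IsMinMap m ∧ ({v | m v = v} : Finset (Fin n)) = C} =
      ∏ v ∈ univ \ C, #{c ∈ C | c < v} := by
  have h : ({m : Fin n → Fin n | IsMinMap m ∧ ({v | m v = v} : Finset (Fin n)) = C} :
      Finset (Fin n → Fin n)) =
      Fintype.piFinset fun v => if v ∈ C then {v} else {c ∈ C | c < v} := by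
    ext m
    simp only [mem_filter, mem_univ, true_and, Fintype.mem_piFinset]
    constructor
    · rintro ⟨hm, rfl⟩ v
      split_ifs with hv
      · simpa using hv
      · simp only [mem_filter, mem_univ, true_and] at hv ⊢
        exact ⟨(hm v).2, lt_of_le_of_ne (hm v).1 hv⟩
    · intro h
      have hC : ∀ v, m v ∈ C ∧ m v ≤ v ∧ (m v = v ↔ v ∈ C) := by
        intro v
        have hv := h v
        split_ifs at hv with hvC
        · simp_all
        · simp only [mem_filter] at hv
          exact ⟨hv.1, hv.2.le, by simp [hvC, hv.2.ne]⟩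
      exact ⟨fun v => ⟨(hC v).2.1, (hC _).2.2.2 (hC v).1⟩, by ext v; simp [(hC v).2.2]⟩
  rw [h, Fintype.card_piFinset, ← prod_sdiff (subset_univ C)]
  conv_rhs => rw [← mul_one (∏ v ∈ univ \ C, _)]
  congr 1
  · exact prod_congr rfl fun v hv => by rw [if_neg (mem_sdiff.1 hv).2]
  · exact prod_eq_one fun v hv => by rw [if_pos hv, card_singleton]

open Classical in
theorem card_isMinMap_card_fixedPoints_eq (n k : ℕ) :
    #{m : Fin n → Fin n | IsMinMap m ∧ #{v | m v = v} = k} = Nat.stirlingSecond n k := by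
  have h := sum_powersetCard_prod_card_filter_lt (univ : Finset (Fin n)) k
  rw [card_univ, Fintype.card_fin] at h
  rw [← h, card_eq_sum_card_fiberwise (f := fun m => ({v | m v = v} : Finset (Fin n)))
    (t := powersetCard k univ) (fun m hm => by simp_all [mem_powersetCard])]
  refine sum_congr rfl fun C hC => ?_
  rw [← card_isMinMap_fixedPoints_eq, filter_filter]
  congr 1
  ext m
  have := (mem_powersetCard.1 hC).2
  simp only [mem_filter, mem_univ, true_and]
  constructor
  · exact fun h => ⟨h.1.1, h.2⟩
  · exact fun h => ⟨⟨h.1, by rw [h.2, this]⟩, h.2⟩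

open Classical in
theorem ofSetoid_ker_parts {n : ℕ} (m : Fin n → Fin n) :
    (Finpartition.ofSetoid (Setoid.ker m)).parts =
      image (fun a => ({b | m a = m b} : Finset (Fin n))) univ := by
  ext s
  simp [Finpartition.ofSetoid, Finpartition.ofSetSetoid]

open Classical in
theorem card_parts_ofSetoid_ker {n : ℕ} {m : Fin n → Fin n} (hm : IsMinMap m) :
    #(Finpartition.ofSetoid (Setoid.ker m)).parts = #{v | m v = v} := by
  have h : (Finpartition.ofSetoid (Setoid.ker m)).parts =
      image (fun a => ({b | m a = m b} : Finset (Fin n))) {v | m v = v} := by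
    rw [ofSetoid_ker_parts]
    ext s
    simp only [mem_image, mem_filter, mem_univ, true_and]
    constructor
    · rintro ⟨a, rfl⟩
      exact ⟨m a, (hm a).2, by simp [(hm a).2]⟩
    · rintro ⟨a, -, rfl⟩
      exact ⟨a, by simp⟩
  rw [h, card_image_of_injOn]
  intro a ha b hb hab
  simp only [coe_filter, mem_univ, true_and, Set.mem_ofPred_eq] at ha hb
  have h := (Finset.ext_iff.1 hab b).2 (by simp)
  simpa [ha, hb] using h

open Classical in
theorem ofSetoid_ker_bijective (n : ℕ) :
    Function.Bijective fun m : {m : Fin n → Fin n // IsMinMap m} =>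
      Finpartition.ofSetoid (Setoid.ker m.1) := by
  constructor
  · rintro ⟨m, hm⟩ ⟨m', hm'⟩ h
    have h' : ∀ a b, m a = m b ↔ m' a = m' b := by
      intro a b
      have h1 := Finpartition.mem_part_ofSetoid_iff_rel (s := Setoid.ker m) (a := a) (b := b)
      have h2 := Finpartition.mem_part_ofSetoid_iff_rel (s := Setoid.ker m') (a := a) (b := b)
      simp only at h
      rw [h] at h1
      exact h1.symm.trans h2
    refine Subtype.ext (funext fun v => le_antisymm (?_ : m v ≤ m' v) (?_ : m' v ≤ m v))
    · rw [← (h' _ _).2 (hm' v).2]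
      exact (hm _).1
    · rw [← (h' _ _).1 (hm v).2]
      exact (hm' _).1
  · intro P
    have hne : ∀ v, (P.part v).Nonempty := fun v => ⟨v, P.mem_part (mem_univ v)⟩
    let m : Fin n → Fin n := fun v => (P.part v).min' (hne v)
    have hpart : ∀ v, P.part (m v) = P.part v := fun v =>
      (P.mem_part_iff_part_eq_part (mem_univ _) (mem_univ _)).1 (min'_mem _ (hne v))
    have hm : IsMinMap m := fun v =>
      ⟨min'_le _ _ (P.mem_part (mem_univ v)), by simp only [m]; congr 1; exact hpart v⟩
    refine ⟨⟨m, hm⟩, ?_⟩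
    have hker : ∀ a b, m a = m b ↔ P.part a = P.part b := fun a b =>
      ⟨fun h => by rw [← hpart a, h, hpart b], fun h => by simp only [m, h]⟩
    have hset : ∀ a, ({b | m a = m b} : Finset (Fin n)) = P.part a := by
      intro a
      ext b
      rw [mem_filter, hker, P.mem_part_iff_part_eq_part (mem_univ _) (mem_univ _)]
      simp [eq_comm]
    refine Finpartition.ext ?_
    rw [ofSetoid_ker_parts]
    ext s
    simp only [mem_image, mem_univ, true_and]
    constructor
    · rintro ⟨a, rfl⟩
      have := P.part_mem.2 (mem_univ a)
      rw [← hset] at this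
      exact this
    · intro hs
      obtain ⟨a, ha⟩ := P.nonempty_of_mem_parts hs
      exact ⟨a, (hset a).trans (P.part_eq_of_mem hs ha)⟩

theorem stirlingSecond_eq (n k : ℕ) : stirlingSecond n k = Nat.stirlingSecond n k := by
  classical
  rw [← card_isMinMap_card_fixedPoints_eq, stirlingSecond]
  have e := (Equiv.ofBijective _ (ofSetoid_ker_bijective n)).subtypeEquiv
    (p := fun m => #{v | m.1 v = v} = k) (q := fun P => #P.parts = k)
    (fun m => by rw [Equiv.ofBijective_apply, card_parts_ofSetoid_ker m.2])
  rw [← Nat.card_congr e, Nat.card_congr (Equiv.subtypeSubtypeEquivSubtypeInter IsMinMap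
    fun m : Fin n → Fin n => #{v | m v = v} = k), Nat.card_eq_fintype_card,
    Fintype.card_subtype]

theorem bellNumber_eq {n N : ℕ} (h : n ≤ N) :
    bellNumber n = ∑ k ∈ range (N + 1), Nat.stirlingSecond n k := by
  classical
  rw [bellNumber, Nat.card_eq_fintype_card, ← card_univ,
    card_eq_sum_card_fiberwise (f := fun P => #P.parts) (t := range (N + 1))]
  · refine sum_congr rfl fun k _ => ?_
    rw [← stirlingSecond_eq, stirlingSecond, Nat.card_eq_fintype_card, Fintype.card_subtype]
  · intro P _
    have := P.card_parts_le_card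
    simp only [card_univ, Fintype.card_fin] at this
    simp only [coe_range, Set.mem_Iio]
    omega

theorem permNumCycles_eq {n : ℕ} (π : Equiv.Perm (Fin n)) :
    permNumCycles π + π.cycleType.sum = π.cycleType.card + n := by
  have h1 : #{x | π x = x} = n - π.cycleType.sum := by
    have h := π.card_fixedPoints
    rw [Fintype.card_fin] at h
    rw [← h, ← Fintype.card_subtype]
    exact Fintype.card_congr (Equiv.refl _)
  have h2 := π.sum_cycleType_le
  rw [Fintype.card_fin] at h2
  rw [permNumCycles, h1]
  omega

/-- Splicing a fixed point into an existing cycle merges two cycles into one. -/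
theorem permNumCycles_swap_mul {n : ℕ} (g : Equiv.Perm (Fin n)) {a b : Fin n} (ha : g a = a)
    (hab : a ≠ b) : permNumCycles (Equiv.swap a b * g) + 1 = permNumCycles g := by
  have hf := permNumCycles_eq (Equiv.swap a b * g)
  have hg := permNumCycles_eq g
  suffices h : (Equiv.swap a b * g).cycleType.sum + g.cycleType.card =
      (Equiv.swap a b * g).cycleType.card + g.cycleType.sum + 1 by omega
  by_cases hb : g b = b
  · have hd : (Equiv.swap a b).Disjoint g := by
      intro x
      by_cases hxa : x = a
      · exact Or.inr (hxa ▸ ha)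
      by_cases hxb : x = b
      · exact Or.inr (hxb ▸ hb)
      exact Or.inl (Equiv.swap_apply_of_ne_of_ne hxa hxb)
    have hs : (Equiv.swap a b).cycleType = {2} :=
      Equiv.Perm.isSwap_iff_cycleType.1 ⟨a, b, hab, rfl⟩
    rw [hd.cycleType_mul, hs]
    simp
    omega
  · set f := Equiv.swap a b * g with hfdef
    have hfa : f a = b := by simp [hfdef, ha]
    have hga : g.symm a = a := by rw [Equiv.symm_apply_eq, ha]
    have hffa : f (f a) ≠ a := by
      rw [hfa]
      intro h
      rw [hfdef, Equiv.Perm.mul_apply, Equiv.swap_apply_eq_iff, Equiv.swap_apply_left] at h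
      exact hb h
    have hfane : f a ≠ a := by rw [hfa]; exact hab.symm
    have hgf : g = Equiv.swap a (f a) * f := by rw [hfa, hfdef, Equiv.swap_mul_self_mul]
    set c := f.cycleOf a with hc
    have hcc : c.IsCycle := Equiv.Perm.isCycle_cycleOf f hfane
    have hca : c a = f a := Equiv.Perm.cycleOf_apply_self f a
    have hcca : c (c a) ≠ a := by
      rw [hca, hc, (Equiv.Perm.SameCycle.refl f a).apply_right.cycleOf_apply]
      exact hffa
    have hcane : c a ≠ a := hca ▸ hfane
    have hd : c.Disjoint (f * c⁻¹) :=
      (Equiv.Perm.disjoint_mul_inv_of_mem_cycleFactorsFinset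
        (Equiv.Perm.cycleOf_mem_cycleFactorsFinset_iff.2
          (Equiv.Perm.mem_support.2 hfane))).symm
    have hf' : f = c * (f * c⁻¹) := by rw [hd.commute.eq]; simp
    have hc' := hcc.swap_mul hcane hcca
    have hsupp := Equiv.Perm.support_swap_mul_eq c a hcca
    have hd' : (Equiv.swap a (c a) * c).Disjoint (f * c⁻¹) := by
      rw [Equiv.Perm.disjoint_iff_disjoint_support, hsupp]
      exact (Equiv.Perm.disjoint_iff_disjoint_support.1 hd).mono_left sdiff_le
    have hg' : g = Equiv.swap a (c a) * c * (f * c⁻¹) := by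
      rw [mul_assoc, ← hf', hca, ← hgf]
    have hfct : f.cycleType = {#c.support} + (f * c⁻¹).cycleType := by
      rw [← hcc.cycleType, ← hd.cycleType_mul, ← hf']
    have hgct : g.cycleType = {#c.support - 1} + (f * c⁻¹).cycleType := by
      rw [hg', hd'.cycleType_mul, hc'.cycleType, hsupp, card_sdiff_of_subset
        (by simpa using hcane), card_singleton]
    have hpos := hcc.two_le_card_support
    rw [hfct, hgct]
    simp
    omega

theorem permNumCycles_decomposeFin_symm_zero {n : ℕ} (e : Equiv.Perm (Fin n)) :
    permNumCycles (Equiv.Perm.decomposeFin.symm (0, e)) = permNumCycles e + 1 := by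
  have h : Equiv.Perm.decomposeFin.symm (0, e) =
      e.extendDomain (finSuccAboveEquiv (0 : Fin (n + 1))) := by
    ext x
    refine Fin.cases ?_ (fun x => ?_) x
    · rw [Equiv.Perm.extendDomain_apply_not_subtype _ _ (by simp)]
      simp
    · have := Equiv.Perm.extendDomain_apply_image e (finSuccAboveEquiv (0 : Fin (n + 1))) x
      have h : e.extendDomain (finSuccAboveEquiv (0 : Fin (n + 1))) x.succ = (e x).succ := this
      simp [h]
  have h1 := permNumCycles_eq (Equiv.Perm.decomposeFin.symm (0, e))
  have h2 := permNumCycles_eq e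
  rw [h, Equiv.Perm.cycleType_extendDomain] at h1
  rw [h]
  omega

theorem permNumCycles_decomposeFin_symm_succ {n : ℕ} (i : Fin n) (e : Equiv.Perm (Fin n)) :
    permNumCycles (Equiv.Perm.decomposeFin.symm (i.succ, e)) = permNumCycles e := by
  have h : Equiv.Perm.decomposeFin.symm (i.succ, e) =
      Equiv.swap 0 i.succ * Equiv.Perm.decomposeFin.symm (0, e) := by
    ext x
    refine Fin.cases ?_ (fun x => ?_) x <;> simp
  have h1 := permNumCycles_swap_mul (Equiv.Perm.decomposeFin.symm (0, e)) (a := 0) (b := i.succ)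
    (by simp) (Fin.succ_ne_zero i).symm
  rw [permNumCycles_decomposeFin_symm_zero, ← h] at h1
  omega

theorem stirlingFirst_eq (n k : ℕ) : stirlingFirst n k = Nat.stirlingFirst n k := by
  induction n generalizing k with
  | zero =>
    rw [stirlingFirst, Nat.card_eq_fintype_card, Fintype.card_subtype]
    cases k with
    | zero => simp [permNumCycles, filter_true_of_mem]
    | succ k => simp [permNumCycles]
  | succ n ih =>
    have h : stirlingFirst (n + 1) k =
        #{e : Equiv.Perm (Fin n) | permNumCycles e + 1 = k} + n * stirlingFirst n k := by
      rw [stirlingFirst, stirlingFirst, Nat.card_eq_fintype_card, Nat.card_eq_fintype_card,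
        Fintype.card_subtype, Fintype.card_subtype, card_filter, card_filter, card_filter,
        ← Equiv.Perm.decomposeFin.symm.sum_comp, Fintype.sum_prod_type, Fin.sum_univ_succ]
      simp [permNumCycles_decomposeFin_symm_zero, permNumCycles_decomposeFin_symm_succ]
    rw [h, ih]
    cases k with
    | zero => cases n <;> simp
    | succ k =>
      rw [Nat.stirlingFirst_succ_succ, ← ih k, stirlingFirst, Nat.card_eq_fintype_card,
        Fintype.card_subtype, add_comm]
      simp

open Classical in
theorem card_forests_of_roots_eq {n : ℕ} (R : Finset (Fin n)) :
    #{p : Fin n → Option (Fin n) | (∀ v w, p v = some w → p w = none ∨ w < v) ∧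
      ({v | p v = none} : Finset (Fin n)) = R} = (#R).ascFactorial (n - #R) := by
  have h : ({p : Fin n → Option (Fin n) | (∀ v w, p v = some w → p w = none ∨ w < v) ∧
      ({v | p v = none} : Finset (Fin n)) = R} : Finset (Fin n → Option (Fin n))) =
      Fintype.piFinset fun v =>
        if v ∈ R then {none} else image some (R ∪ {w ∈ univ \ R | w < v}) := by
    ext p
    simp only [mem_filter, mem_univ, true_and, Fintype.mem_piFinset]
    constructor
    · rintro ⟨hp, rfl⟩ v
      split_ifs with hv
      · simpa using hv
      · simp only [mem_filter, mem_univ, true_and] at hv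
        obtain ⟨w, hw⟩ := Option.ne_none_iff_exists'.1 hv
        rw [hw, mem_image]
        refine ⟨w, ?_, rfl⟩
        by_cases hwn : p w = none
        · simp [hwn]
        · simp [hwn, (hp v w hw).resolve_left hwn]
    · intro h
      have hR : ∀ v, p v = none ↔ v ∈ R := by
        intro v
        have hv := h v
        split_ifs at hv with hvR
        · simp_all
        · obtain ⟨w, -, hw⟩ := mem_image.1 hv
          simp [← hw, hvR]
      refine ⟨fun v w hvw => ?_, by ext v; simp [hR]⟩
      have hv := h v
      rw [if_neg (by rw [← hR, hvw]; simp), hvw] at hv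
      simp only [mem_image, mem_union, mem_filter, mem_sdiff, Option.some.injEq,
        exists_eq_right] at hv
      rw [hR]
      exact hv.imp_right And.right
  have hc : #(univ \ R) = n - #R := by
    rw [card_sdiff_of_subset (subset_univ R), card_univ, Fintype.card_fin]
  rw [h, Fintype.card_piFinset, ← prod_sdiff (subset_univ R), ← hc, ← prod_add_card_filter_lt]
  conv_rhs => rw [← mul_one (∏ v ∈ univ \ R, _)]
  congr 1
  · refine prod_congr rfl fun v hv => ?_
    rw [if_neg (mem_sdiff.1 hv).2, card_image_of_injective _ (Option.some_injective _),
      card_union_of_disjoint]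
    exact disjoint_sdiff.mono_right (filter_subset _ _)
  · exact prod_eq_one fun v hv => by rw [if_pos hv, card_singleton]

open Classical in
theorem card_forests_of_core_eq {n : ℕ} (C : Finset (Fin n)) :
    #{p : Fin n → Option (Fin n) |
      (∀ v w, p v = some w → ∀ u, p w = some u → w < u) ∧
      ({v | ∀ u, p v = some u → v < u} : Finset (Fin n)) = C} =
      (#C).factorial * ∏ v ∈ univ \ C, #{c ∈ C | c < v} := by
  have h : ({p : Fin n → Option (Fin n) |
      (∀ v w, p v = some w → ∀ u, p w = some u → w < u) ∧
      ({v | ∀ u, p v = some u → v < u} : Finset (Fin n)) = C} :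
      Finset (Fin n → Option (Fin n))) =
      Fintype.piFinset fun v =>
        if v ∈ C then insertNone {w ∈ C | v < w} else image some {c ∈ C | c < v} := by
    ext p
    simp only [mem_filter, mem_univ, true_and, Fintype.mem_piFinset]
    constructor
    · rintro ⟨hp, rfl⟩ v
      split_ifs with hv
      · simp only [mem_filter, mem_univ, true_and] at hv
        simp only [mem_insertNone, mem_filter, mem_univ, true_and]
        exact fun w hw => ⟨hp v w hw, hv w hw⟩
      · simp only [mem_filter, mem_univ, true_and] at hv
        push Not at hv
        obtain ⟨w, hw, hwv⟩ := hv
        have hne : w ≠ v := by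
          rintro rfl
          exact lt_irrefl _ (hp w w hw w hw)
        rw [hw]
        exact mem_image_of_mem _ (mem_filter.2
          ⟨mem_filter.2 ⟨mem_univ _, hp v w hw⟩, lt_of_le_of_ne hwv hne⟩)
    · intro h
      have hC : ∀ v w, p v = some w → w ∈ C ∧ (v ∈ C ↔ v < w) := by
        intro v w hw
        have hv := h v
        rw [hw] at hv
        split_ifs at hv with hvC
        · have := mem_insertNone.1 hv w rfl
          simp_all
        · obtain ⟨w', hw', rfl⟩ : ∃ w' ∈ {c ∈ C | c < v}, w' = w := by simpa using hv
          simp_all [le_of_lt]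
      have hC' : ∀ v, p v = none → v ∈ C := by
        intro v hv
        have := h v
        by_contra hvC
        simp [hv, hvC] at this
      refine ⟨fun v w hvw u hwu => (hC w u hwu).2.1 (hC v w hvw).1, ?_⟩
      ext v
      simp only [mem_filter, mem_univ, true_and]
      cases hv : p v with
      | none => simp [hC' v hv]
      | some w => simp [(hC v w hv).2]
  rw [h, Fintype.card_piFinset, ← prod_sdiff (subset_univ C), mul_comm,
    ← prod_card_filter_gt_add_one]
  congr 1
  · exact prod_congr rfl fun v hv => by rw [if_pos hv, card_insertNone]
  · refine prod_congr rfl fun v hv => ?_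
    rw [if_neg (mem_sdiff.1 hv).2, card_image_of_injective _ (Option.some_injective _)]

theorem count_forests_avoiding_132_231_321_and_132_231_123 (n : ℕ) (hn : 1 ≤ n) :
    Nat.card {p : Fin n → Option (Fin n) //
        IsForest p ∧ ForestAvoids p [1, 3, 2] ∧ ForestAvoids p [2, 3, 1] ∧
        ForestAvoids p [3, 2, 1]} =
      ∑ k ∈ Finset.Icc 1 n, bellNumber k * stirlingFirst n k ∧
    Nat.card {p : Fin n → Option (Fin n) //
        IsForest p ∧ ForestAvoids p [1, 3, 2] ∧ ForestAvoids p [2, 3, 1] ∧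
        ForestAvoids p [1, 2, 3]} =
      ∑ k ∈ Finset.Icc 1 n, k.factorial * stirlingSecond n k := by
  classical
  have hIcc : ∀ f : ℕ → ℕ, f 0 = 0 → ∑ k ∈ Icc 1 n, f k = ∑ k ∈ range (n + 1), f k := by
    intro f h0
    rw [sum_range_succ', h0, add_zero, range_eq_Ico, sum_Ico_add' f 0 n 1]
    rfl
  obtain ⟨n, rfl⟩ := Nat.exists_eq_add_of_le' hn
  constructor
  · simp only [isForest_and_avoids_132_231_321_iff]
    rw [hIcc _ (by rw [stirlingFirst_eq]; simp), Nat.card_eq_fintype_card, Fintype.card_subtype,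
      card_eq_sum_card_fiberwise (f := fun p => ({v | p v = none} : Finset (Fin (n + 1))))
        (t := univ.powerset) (fun _ _ => by simp)]
    simp only [filter_filter, card_forests_of_roots_eq]
    rw [sum_powerset_apply_card (fun k => k.ascFactorial (n + 1 - k)), card_univ,
      Fintype.card_fin]
    simp only [smul_eq_mul, ← sum_stirlingFirst_mul_stirlingSecond]
    rw [sum_comm]
    refine sum_congr rfl fun k hk => ?_
    rw [← mul_sum, ← bellNumber_eq (Nat.lt_succ_iff.1 (mem_range.1 hk)), stirlingFirst_eq,
      mul_comm]
  · simp only [isForest_and_avoids_132_231_123_iff]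
    rw [hIcc _ (by rw [stirlingSecond_eq]; simp), Nat.card_eq_fintype_card, Fintype.card_subtype,
      card_eq_sum_card_fiberwise
        (f := fun p => ({v | ∀ u, p v = some u → v < u} : Finset (Fin (n + 1))))
        (t := univ.powerset) (fun _ _ => by simp)]
    simp only [filter_filter, card_forests_of_core_eq]
    rw [sum_powerset, card_univ, Fintype.card_fin]
    refine sum_congr rfl fun k _ => ?_
    have h := sum_powersetCard_prod_card_filter_lt (univ : Finset (Fin (n + 1))) k
    rw [card_univ, Fintype.card_fin] at h
    rw [stirlingSecond_eq, ← h, mul_sum]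
    exact sum_congr rfl fun C hC => by rw [(mem_powersetCard.1 hC).2]
end

section
/- For all n ≥ 1, the number of rooted labeled forests on [n] avoiding all three patterns 312, 213, and 132 equals ∑_{k=1}^{n} (n!/k!)·C(n−1,k−1), where C(a,b) denotes the binomial coefficient. -/
open Finset in
/-- If each element `v` of `S` other than `r` chooses an element of `S` that is at least `r` and
less than `v` (when `r < v`), or that is greater than `v` (when `v < r`), then there are
`(#S - 1)!` possible systems of choices. -/
lemma prod_card_choices_eq_factorial {α : Type*} [LinearOrder α] (S : Finset α) {r : α}
    (hr : r ∈ S) :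
    ∏ v ∈ S.erase r, #{u ∈ S | r ≤ u ∧ u < v ∨ v < r ∧ v < u} = (#S - 1).factorial := by
  have prod_card_Iio : ∀ T : Finset α, (∀ v ∈ T, r < v) →
      ∏ v ∈ T, #{u ∈ insert r T | u < v} = (#T).factorial := by
    intro T
    induction T using Finset.induction_on_max with
    | empty => simp
    | insert a T ha ih =>
      intro h
      have haT : a ∉ T := fun h' => lt_irrefl _ (ha a h')
      rw [prod_insert haT, card_insert_of_notMem haT, Nat.factorial_succ,
        ← ih fun v hv => h v (mem_insert_of_mem hv)]
      congr 1
      · have : {u ∈ insert r (insert a T) | u < a} = insert r T := by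
          ext u
          have := h a (mem_insert_self _ _)
          simp only [mem_filter, mem_insert]
          grind
        rw [this, card_insert_of_notMem]
        exact fun h' => lt_irrefl _ (h r (mem_insert_of_mem h'))
      · refine prod_congr rfl fun v hv => congrArg card ?_
        ext u
        have := ha v hv
        simp only [mem_filter, mem_insert]
        grind
  induction S using Finset.induction_on_min with
  | empty => simp at hr
  | insert a S ha ih =>
    have haS : a ∉ S := fun h' => lt_irrefl _ (ha a h')
    rw [card_insert_of_notMem haS, Nat.add_sub_cancel]
    rcases eq_or_ne r a with rfl | hra
    · rw [erase_insert haS, ← prod_card_Iio S ha]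
      refine prod_congr rfl fun v hv => congrArg card ?_
      ext u
      have := ha v hv
      simp only [mem_filter, mem_insert]
      grind
    · have hrS : r ∈ S := mem_of_mem_insert_of_ne hr hra
      have har := ha r hrS
      rw [erase_insert_of_ne hra.symm, prod_insert (fun h => haS (mem_of_mem_erase h)),
        ← Nat.mul_factorial_pred (card_ne_zero_of_mem hrS), ← ih hrS]
      congr 1
      · refine congrArg card ?_
        ext u
        simp only [mem_filter, mem_insert]
        grind
      · refine prod_congr rfl fun v hv => congrArg card ?_
        ext u
        have := ha v (mem_of_mem_erase hv)
        simp only [mem_filter, mem_insert]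
        grind

open Finset in
/-- The number of ways to distribute the elements of `T` into linearly ordered lists indexed
by `R`, as a sum over all the maps from `T` to `R`, extended by the identity outside `T`. -/
lemma sum_prod_factorial_card_fiber {α : Type*} [Fintype α] [DecidableEq α] (R T : Finset α) :
    ∑ f ∈ Fintype.piFinset (fun v => if v ∈ T then R else {v}),
      ∏ r ∈ R, (#{v ∈ T | f v = r}).factorial = (#R).ascFactorial #T := by
  induction T using Finset.induction_on with
  | empty => simp
  | insert a T ha ih =>
    have sum_eq : ∑ f ∈ Fintype.piFinset (fun v => if v ∈ insert a T then R else {v}),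
        ∏ r ∈ R, (#{v ∈ insert a T | f v = r}).factorial =
        ∑ q ∈ Fintype.piFinset (fun v => if v ∈ T then R else {v}) ×ˢ R,
          ∏ r ∈ R, (#{v ∈ insert a T | Function.update q.1 a q.2 v = r}).factorial := by
      refine sum_bij' (fun f _ => (Function.update f a a, f a))
        (fun q _ => Function.update q.1 a q.2) ?_ ?_ ?_ ?_ ?_
      · intro f hf
        rw [Fintype.mem_piFinset] at hf
        rw [mem_product, Fintype.mem_piFinset]
        refine ⟨fun v => ?_, by simpa using hf a⟩
        have := hf v
        rcases eq_or_ne v a with rfl | hva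
        · simp [ha]
        · simpa [hva] using this
      · rintro ⟨f, x⟩ hq
        rw [mem_product, Fintype.mem_piFinset] at hq
        rw [Fintype.mem_piFinset]
        intro v
        have := hq.1 v
        rcases eq_or_ne v a with rfl | hva
        · simpa using hq.2
        · simpa [hva] using this
      · intro f _
        simp
      · rintro ⟨f, x⟩ hq
        rw [mem_product, Fintype.mem_piFinset] at hq
        have := hq.1 a
        rw [if_neg ha, mem_singleton] at this
        change f a = a at this
        have h := Function.update_eq_self a f
        rw [this] at h
        simp [h]
      · intro f _
        simp
    rw [sum_eq, sum_product, card_insert_of_notMem ha, Nat.ascFactorial_succ, ← ih, mul_sum]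
    refine sum_congr rfl fun f hf => ?_
    rw [Fintype.mem_piFinset] at hf
    have card_fiber : ∀ x r, #{v ∈ insert a T | Function.update f a x v = r} =
        #{v ∈ T | f v = r} + if x = r then 1 else 0 := by
      intro x r
      have h : {v ∈ T | Function.update f a x v = r} = {v ∈ T | f v = r} := by
        refine filter_congr fun v hv => ?_
        rw [Function.update_of_ne (ne_of_mem_of_not_mem hv ha)]
      rw [filter_insert, Function.update_self, h]
      split_ifs
      · rw [card_insert_of_notMem (by simp [ha])]
      · simp
    have prod_eq : ∀ x ∈ R,
        ∏ r ∈ R, (#{v ∈ insert a T | Function.update f a x v = r}).factorial =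
        (#{v ∈ T | f v = x} + 1) * ∏ r ∈ R, (#{v ∈ T | f v = r}).factorial := by
      intro x hx
      rw [← mul_prod_erase R _ hx, ← mul_prod_erase R (fun r => (#{v ∈ T | f v = r}).factorial) hx,
        card_fiber, if_pos rfl, Nat.factorial_succ, mul_assoc]
      congr 2
      refine prod_congr rfl fun r hr => ?_
      rw [card_fiber, if_neg (ne_of_mem_erase hr).symm, add_zero]
    rw [sum_congr rfl prod_eq, ← sum_mul, sum_add_distrib,
      ← card_eq_sum_card_fiberwise (f := f) (s := T) (t := R)]
    · simp [add_comm]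
    · intro v hv
      simpa [mem_coe.mp hv] using hf v

/-- `o` is an admissible parent of `v` in a forest with root map `ρ`: the roots are the fixed
points of `ρ`, and the parent of any other vertex `v` lies in the same tree, and is in
`[ρ v, v)` if `v` is larger than its root, and in `(v, ∞)` if `v` is smaller than its root. -/
def IsAdmissibleParent {n : ℕ} (ρ : Fin n → Fin n) (v : Fin n) : Option (Fin n) → Prop
  | none => ρ v = v
  | some u => ρ u = ρ v ∧ (ρ v ≤ u ∧ u < v ∨ v < ρ v ∧ v < u)

section

variable {n : ℕ} {p : Fin n → Option (Fin n)} {ρ : Fin n → Fin n}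

lemma IsAdmissibleParent.eq_none_iff {v : Fin n} {o : Option (Fin n)}
    (h : IsAdmissibleParent ρ v o) : o = none ↔ ρ v = v := by
  cases o <;> simp only [IsAdmissibleParent] at h <;> grind

lemma isForest_of_isAdmissibleParent (h : ∀ v, IsAdmissibleParent ρ v (p v)) : IsForest p := by
  refine ⟨fun v => if ρ v ≤ v then v else n + (n - v), fun v w hvw => ?_⟩
  have := h v
  simp only [hvw, IsAdmissibleParent] at this
  obtain ⟨h1, h2⟩ := this
  simp only [h1, Fin.le_def, Fin.lt_def] at h2 ⊢
  split_ifs <;> omega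

lemma StrictAnc.of_isAdmissibleParent (h : ∀ v, IsAdmissibleParent ρ v (p v)) {a b : Fin n}
    (hab : StrictAnc p a b) : ρ a = ρ b ∧ (ρ b ≤ a ∧ a < b ∨ b < ρ b ∧ b < a) := by
  have step : ∀ {x y}, p y = some x → ρ x = ρ y ∧ (ρ y ≤ x ∧ x < y ∨ y < ρ y ∧ y < x) := by
    intro x y hxy
    simpa only [hxy, IsAdmissibleParent] using h y
  induction hab with
  | single hab => exact step hab
  | tail _ hbc ih =>
    have := step hbc
    grind

lemma forestAvoids_of_isAdmissibleParent (h : ∀ v, IsAdmissibleParent ρ v (p v)) :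
    ForestAvoids p [3, 1, 2] ∧ ForestAvoids p [2, 1, 3] ∧ ForestAvoids p [1, 3, 2] := by
  refine ⟨?_, ?_, ?_⟩ <;>
  · rintro ⟨u, hu, hσ⟩
    have h01 := (hu 0 1 (by decide)).of_isAdmissibleParent h
    have h12 := (hu 1 2 (by decide)).of_isAdmissibleParent h
    have l01 := hσ 0 1
    have l02 := hσ 0 2
    have l12 := hσ 1 2
    have l10 := hσ 1 0
    have l20 := hσ 2 0
    have l21 := hσ 2 1
    simp at l01 l02 l12 l10 l20 l21
    grind

lemma rootMap_unique (hp : IsForest p) {ρ' : Fin n → Fin n}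
    (h : ∀ v, IsAdmissibleParent ρ v (p v)) (h' : ∀ v, IsAdmissibleParent ρ' v (p v)) :
    ρ = ρ' := by
  obtain ⟨d, hd⟩ := hp
  funext v
  induction hv : d v using Nat.strong_induction_on generalizing v with
  | _ m ih =>
    subst hv
    have h1 := h v
    have h2 := h' v
    cases hpv : p v with
    | none =>
      simp only [hpv, IsAdmissibleParent] at h1 h2
      rw [h1, h2]
    | some u =>
      simp only [hpv, IsAdmissibleParent] at h1 h2
      rw [← h1.1, ← h2.1, ih _ (hd v u hpv) u rfl]

lemma rootMap_idempotent (h : ∀ v, IsAdmissibleParent ρ v (p v)) (v : Fin n) :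
    ρ (ρ v) = ρ v := by
  obtain ⟨d, hd⟩ := isForest_of_isAdmissibleParent h
  induction hv : d v using Nat.strong_induction_on generalizing v with
  | _ m ih =>
    subst hv
    have h1 := h v
    cases hpv : p v with
    | none =>
      simp only [hpv, IsAdmissibleParent] at h1
      rw [h1, h1]
    | some u =>
      simp only [hpv, IsAdmissibleParent] at h1
      rw [← h1.1, ih _ (hd v u hpv) u rfl]

/-- Every vertex of a forest has a root among its weak ancestors, compatibly with parents. -/
lemma IsForest.exists_rootMap (hp : IsForest p) :
    ∃ ρ : Fin n → Fin n, (∀ v, p v = none → ρ v = v) ∧ (∀ v u, p v = some u → ρ u = ρ v) ∧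
      (∀ v, p (ρ v) = none) ∧
      ∀ v, Relation.ReflTransGen (fun x y : Fin n => p y = some x) (ρ v) v := by
  obtain ⟨d, hd⟩ := hp
  let s : Fin n → Fin n := fun v => (p v).getD v
  have s_none : ∀ v, p v = none → s v = v := fun v hv => by simp [s, hv]
  have s_some : ∀ v u, p v = some u → s v = u := fun v u hv => by simp [s, hv]
  have iterate_none : ∀ m v, d v ≤ m → p (s^[m] v) = none := by
    intro m
    induction m with
    | zero =>
      intro v hv
      cases hpv : p v with
      | none => simpa using hpv
      | some u => have := hd v u hpv; omega
    | succ m ih =>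
      intro v hv
      rw [Function.iterate_succ_apply]
      cases hpv : p v with
      | none =>
        rw [s_none v hpv, Function.iterate_fixed (s_none v hpv), hpv]
      | some u =>
        rw [s_some v u hpv]
        have := hd v u hpv
        exact ih u (by omega)
  have iterate_anc : ∀ m v,
      Relation.ReflTransGen (fun x y : Fin n => p y = some x) (s^[m] v) v := by
    intro m
    induction m with
    | zero => exact fun v => .refl
    | succ m ih =>
      intro v
      rw [Function.iterate_succ_apply]
      cases hpv : p v with
      | none => rw [s_none v hpv]; exact ih v
      | some u => rw [s_some v u hpv]; exact (ih u).tail hpv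
  have root : ∀ v, p (s^[Finset.univ.sup d] v) = none :=
    fun v => iterate_none _ v (Finset.le_sup (Finset.mem_univ v))
  refine ⟨s^[Finset.univ.sup d], fun v hv => Function.iterate_fixed (s_none v hv) _, ?_, root,
    iterate_anc _⟩
  intro v u hvu
  rw [← s_some v u hvu, ← Function.iterate_succ_apply, Function.iterate_succ_apply',
    s_none _ (root v)]

lemma exists_isAdmissibleParent (hp : IsForest p) (h312 : ForestAvoids p [3, 1, 2])
    (h213 : ForestAvoids p [2, 1, 3]) (h132 : ForestAvoids p [1, 3, 2]) :
    ∃ ρ : Fin n → Fin n, ∀ v, IsAdmissibleParent ρ v (p v) := by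
  obtain ⟨ρ, hnone, hsome, hroot, hanc⟩ := hp.exists_rootMap
  obtain ⟨d, hd⟩ := hp
  refine ⟨ρ, fun v => ?_⟩
  cases hpv : p v with
  | none => exact hnone v hpv
  | some u =>
    refine ⟨hsome v u hpv, ?_⟩
    have hvu : v ≠ u := by
      rintro rfl
      exact lt_irrefl _ (hd v v hpv)
    have hρv : ρ v ≠ v := by
      intro h
      have := hroot v
      rw [h, hpv] at this
      cases this
    have hρu := hanc u
    rw [hsome v u hpv] at hρu
    rcases Relation.reflTransGen_iff_eq_or_transGen.mp hρu with h | h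
    · rw [h] at hvu ⊢
      grind
    · have huv : StrictAnc p u v := .single hpv
      have hρuv : StrictAnc p (ρ v) v := h.tail hpv
      have chain : ∀ i j : Fin 3, i < j →
          StrictAnc p ((![ρ v, u, v] : Fin 3 → Fin n) i) ((![ρ v, u, v] : Fin 3 → Fin n) j) := by
        intro i j hij
        fin_cases i <;> fin_cases j <;> first | exact absurd hij (by decide) | assumption
      by_contra hcon
      have cases3 : u < v ∧ v < ρ v ∨ u < ρ v ∧ ρ v < v ∨ ρ v < v ∧ v < u := by grind
      rcases cases3 with ⟨h1, h2⟩ | ⟨h1, h2⟩ | ⟨h1, h2⟩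
      · refine h312 ⟨![ρ v, u, v], chain, fun i j => ?_⟩
        fin_cases i <;> fin_cases j <;> simp <;> grind
      · refine h213 ⟨![ρ v, u, v], chain, fun i j => ?_⟩
        fin_cases i <;> fin_cases j <;> simp <;> grind
      · refine h132 ⟨![ρ v, u, v], chain, fun i j => ?_⟩
        fin_cases i <;> fin_cases j <;> simp <;> grind

lemma forest_avoids_iff_exists_isAdmissibleParent :
    (IsForest p ∧ ForestAvoids p [3, 1, 2] ∧ ForestAvoids p [2, 1, 3] ∧
      ForestAvoids p [1, 3, 2]) ↔ ∃ ρ : Fin n → Fin n, ∀ v, IsAdmissibleParent ρ v (p v) :=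
  ⟨fun ⟨hp, h1, h2, h3⟩ => exists_isAdmissibleParent hp h1 h2 h3,
    fun ⟨_, h⟩ => ⟨isForest_of_isAdmissibleParent h, forestAvoids_of_isAdmissibleParent h⟩⟩

end

open Finset in
open scoped Classical in
/-- The number of admissible forests with a given idempotent root map with image `R`. -/
lemma card_admissible_of_mem_piFinset {n : ℕ} {ρ : Fin n → Fin n} {R : Finset (Fin n)}
    (hρ : ρ ∈ Fintype.piFinset (fun v => if v ∈ Rᶜ then R else {v})) :
    #{p : Fin n → Option (Fin n) | ∀ v, IsAdmissibleParent ρ v (p v)} =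
      ∏ r ∈ R, (#{v ∈ Rᶜ | ρ v = r}).factorial := by
  rw [Fintype.mem_piFinset] at hρ
  have fixed : ∀ v ∈ R, ρ v = v := fun v hv => by simpa [hv] using hρ v
  have maps : ∀ v, ρ v ∈ R := by
    intro v
    by_cases hv : v ∈ R
    · rwa [fixed v hv]
    · simpa [hv] using hρ v
  have card_parents_root : ∀ v, ρ v = v → #{o | IsAdmissibleParent ρ v o} = 1 := by
    intro v hv
    rw [card_eq_one]
    refine ⟨none, ?_⟩
    ext o
    simp only [mem_filter, mem_univ, true_and, mem_singleton]
    refine ⟨fun h => h.eq_none_iff.mpr hv, ?_⟩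
    rintro rfl
    exact hv
  have card_parents : ∀ v, ρ v ≠ v → #{o | IsAdmissibleParent ρ v o} =
      #{u ∈ ({w | ρ w = ρ v} : Finset (Fin n)) | ρ v ≤ u ∧ u < v ∨ v < ρ v ∧ v < u} := by
    intro v hv
    rw [eq_comm, ← card_map Function.Embedding.some]
    congr 1
    ext o
    cases o <;> simp [IsAdmissibleParent, hv]
  have card_pi : #{p : Fin n → Option (Fin n) | ∀ v, IsAdmissibleParent ρ v (p v)} =
      ∏ v, #{o | IsAdmissibleParent ρ v o} := by
    rw [← Fintype.card_piFinset]
    congr 1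
    ext p
    simp
  rw [card_pi, ← prod_fiberwise_of_maps_to (g := ρ) (t := R) (fun v _ => maps v)]
  refine prod_congr rfl fun r hr => ?_
  have hrS : r ∈ ({v | ρ v = r} : Finset (Fin n)) := by simpa using fixed r hr
  have fiber_erase : ({v | ρ v = r} : Finset (Fin n)).erase r =
      ({v ∈ Rᶜ | ρ v = r} : Finset (Fin n)) := by
    ext v
    simp only [mem_erase, mem_filter, mem_univ, true_and, mem_compl]
    grind
  rw [← fiber_erase, card_erase_of_mem hrS, ← prod_card_choices_eq_factorial _ hrS,
    ← mul_prod_erase _ _ hrS, card_parents_root r (fixed r hr), one_mul]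
  refine prod_congr rfl fun v hv => ?_
  obtain ⟨hvr, hv⟩ := mem_erase.mp hv
  rw [mem_filter] at hv
  rw [card_parents v (by rw [hv.2]; exact hvr.symm), hv.2]

open Finset in
lemma card_exists_isAdmissibleParent (n : ℕ) :
    Nat.card {p : Fin n → Option (Fin n) //
      ∃ ρ : Fin n → Fin n, ∀ v, IsAdmissibleParent ρ v (p v)} =
    ∑ R : Finset (Fin n), (#R).ascFactorial (n - #R) := by
  classical
  let fiber : Finset (Fin n) → Finset (Fin n → Fin n) :=
    fun R => Fintype.piFinset (fun v => if v ∈ Rᶜ then R else {v})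
  let forests : (Fin n → Fin n) → Finset (Fin n → Option (Fin n)) :=
    fun ρ => {p | ∀ v, IsAdmissibleParent ρ v (p v)}
  have mem_forests : ∀ {ρ p}, p ∈ forests ρ ↔ ∀ v, IsAdmissibleParent ρ v (p v) := by
    simp [forests]
  have mem_fiber : ∀ {ρ R}, ρ ∈ fiber R ↔ (∀ v ∈ R, ρ v = v) ∧ ∀ v ∉ R, ρ v ∈ R := by
    intro ρ R
    simp only [fiber, Fintype.mem_piFinset, mem_compl]
    refine ⟨fun h => ⟨fun v hv => by simpa [hv] using h v, fun v hv => by simpa [hv] using h v⟩,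
      fun h v => ?_⟩
    by_cases hv : v ∈ R
    · simpa [hv] using h.1 v hv
    · simpa [hv] using h.2 v hv
  have mem_iff_fixed : ∀ {ρ R}, ρ ∈ fiber R → ∀ v, v ∈ R ↔ ρ v = v := by
    intro ρ R h v
    rw [mem_fiber] at h
    refine ⟨h.1 v, fun hv => ?_⟩
    by_contra hvR
    exact hvR (hv ▸ h.2 v hvR)
  have card_eq : Nat.card {p : Fin n → Option (Fin n) //
      ∃ ρ : Fin n → Fin n, ∀ v, IsAdmissibleParent ρ v (p v)} =
      #((univ : Finset (Finset (Fin n))).biUnion fun R => (fiber R).biUnion forests) := by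
    rw [Nat.card_eq_fintype_card, Fintype.card_subtype]
    congr 1
    ext p
    simp only [mem_filter, mem_univ, true_and, mem_biUnion, mem_forests]
    constructor
    · rintro ⟨ρ, h⟩
      refine ⟨({v | ρ v = v} : Finset (Fin n)), ρ, mem_fiber.mpr ⟨by simp, fun v _ => ?_⟩, h⟩
      simpa using rootMap_idempotent h v
    · rintro ⟨_, ρ, _, h⟩
      exact ⟨ρ, h⟩
  have forests_unique : ∀ {ρ ρ' p}, p ∈ forests ρ → p ∈ forests ρ' → ρ = ρ' := by
    intro ρ ρ' p h h'
    rw [mem_forests] at h h'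
    exact rootMap_unique (isForest_of_isAdmissibleParent h) h h'
  have forests_disjoint : ∀ ρ ρ', ρ ≠ ρ' → Disjoint (forests ρ) (forests ρ') :=
    fun ρ ρ' hne => disjoint_left.mpr fun p h h' => hne (forests_unique h h')
  rw [card_eq, card_biUnion]
  · refine sum_congr rfl fun R _ => ?_
    rw [card_biUnion fun ρ _ ρ' _ hne => forests_disjoint ρ ρ' hne,
      sum_congr rfl fun ρ hρ => card_admissible_of_mem_piFinset hρ,
      sum_prod_factorial_card_fiber, card_compl, Fintype.card_fin]
  · intro R _ R' _ hne
    refine disjoint_left.mpr fun p h h' => hne ?_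
    obtain ⟨ρ, hρ, h⟩ := mem_biUnion.mp h
    obtain ⟨ρ', hρ', h'⟩ := mem_biUnion.mp h'
    obtain rfl := forests_unique h h'
    ext v
    rw [mem_iff_fixed hρ, mem_iff_fixed hρ']

lemma choose_mul_ascFactorial_eq {n k : ℕ} (hk : 1 ≤ k) (hkn : k ≤ n) :
    n.choose k * k.ascFactorial (n - k) =
      (n.factorial / k.factorial) * (n - 1).choose (k - 1) := by
  obtain ⟨j, rfl⟩ := Nat.exists_eq_add_of_le' hk
  obtain ⟨m, rfl⟩ := Nat.exists_eq_add_of_le hkn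
  have h1 := Nat.choose_mul_factorial_mul_factorial (Nat.le_add_right (j + 1) m)
  rw [Nat.add_sub_cancel_left] at h1
  have h2 := Nat.factorial_mul_ascFactorial j m
  have h3 := Nat.choose_mul_factorial_mul_factorial (Nat.le_add_right j m)
  rw [Nat.add_sub_cancel_left] at h3
  have h4 : (j + 1 + m).factorial / (j + 1).factorial = (j + 1 + m).choose (j + 1) * m.factorial :=
    Nat.div_eq_of_eq_mul_left (Nat.factorial_pos _) (by rw [← h1]; ring)
  rw [h4, Nat.add_sub_cancel_left, Nat.add_sub_cancel, show j + 1 + m - 1 = j + m by omega,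
    mul_assoc]
  congr 1
  refine Nat.eq_of_mul_eq_mul_left (Nat.factorial_pos j) ?_
  rw [h2, ← h3]
  ring

theorem count_forests_avoiding_312_213_132 (n : ℕ) (hn : 1 ≤ n) :
    Nat.card {p : Fin n → Option (Fin n) //
        IsForest p ∧ ForestAvoids p [3, 1, 2] ∧ ForestAvoids p [2, 1, 3] ∧
        ForestAvoids p [1, 3, 2]} =
    ∑ k ∈ Finset.Icc 1 n, (n.factorial / k.factorial) * (n - 1).choose (k - 1) := by
  simp_rw [forest_avoids_iff_exists_isAdmissibleParent]
  rw [card_exists_isAdmissibleParent, ← Finset.powerset_univ,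
    Finset.sum_powerset_apply_card (fun k => k.ascFactorial (n - k)), Finset.card_univ,
    Fintype.card_fin, Finset.sum_range_succ', Finset.range_eq_Ico,
    Finset.sum_Ico_add' (fun k => n.choose k • k.ascFactorial (n - k))]
  have h0 : Nat.ascFactorial 0 (n - 0) = 0 := by
    obtain ⟨m, rfl⟩ := Nat.exists_eq_add_of_le' hn
    simp [Nat.zero_ascFactorial]
  rw [h0, smul_zero, add_zero, zero_add, Finset.Ico_add_one_right_eq_Icc]
  refine Finset.sum_congr rfl fun k hk => ?_
  rw [Finset.mem_Icc] at hk
  rw [smul_eq_mul, choose_mul_ascFactorial_eq hk.1 hk.2]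
end

section
/- Let F(n) denote the number of rooted labeled forests on [n] avoiding all three patterns 213, 312, and 231, with the convention F(0) = 1. Then F(1) = 1 and for all n ≥ 1, F(n) = ∑_{k=1}^{n} ∑_{r=1}^{k} C(n−1,k−1)·(r−1)!·F(n−k)·F(k−r). -/
open Finset in
/-- `∑_{r ∈ S} f(#{x ∈ S | x < r})` only depends on the size of `S`. -/
theorem Finset.sum_card_filter_lt {α M : Type*} [LinearOrder α] [AddCommMonoid M]
    (S : Finset α) (f : ℕ → M) :
    ∑ r ∈ S, f #{x ∈ S | x < r} = ∑ i ∈ range #S, f i := by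
  induction S using Finset.induction_on_max with
  | empty => simp
  | insert a S ha ih =>
    have haS : a ∉ S := fun h => lt_irrefl _ (ha a h)
    rw [sum_insert haS, card_insert_of_notMem haS, sum_range_succ, ← ih, add_comm]
    congr 1
    · refine sum_congr rfl fun r hr => ?_
      rw [filter_insert, if_neg (not_lt.2 (ha r hr).le)]
    · rw [filter_insert, if_neg (lt_irrefl a), filter_true_of_mem ha]

open Finset in
theorem Finset.prod_card_filter_le {α : Type*} [LinearOrder α] (B : Finset α) :
    ∏ x ∈ B, #{y ∈ B | x ≤ y} = (#B).factorial := by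
  induction B using Finset.induction_on_min with
  | empty => simp
  | insert a B ha ih =>
    have haB : a ∉ B := fun h => lt_irrefl _ (ha a h)
    rw [prod_insert haB, card_insert_of_notMem haB, Nat.factorial_succ, ← ih]
    congr 1
    · rw [filter_insert, if_pos le_rfl, filter_true_of_mem fun x hx => (ha x hx).le,
        card_insert_of_notMem haB]
    · refine prod_congr rfl fun r hr => ?_
      rw [filter_insert, if_neg (not_le.2 (ha r hr))]

open Finset in
/-- Summing a function of the size over the subsets containing a given element. -/
theorem Finset.sum_filter_mem_apply_card {α M : Type*} [Fintype α] [DecidableEq α]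
    [AddCommMonoid M] (m : α) (f : ℕ → M) :
    ∑ S : Finset α with m ∈ S, f #S =
      ∑ i ∈ range (Fintype.card α), (Fintype.card α - 1).choose i • f (i + 1) := by
  have hc : #(univ.erase m) = Fintype.card α - 1 := by simp [card_erase_of_mem]
  have hpos : 0 < Fintype.card α := Fintype.card_pos_iff.2 ⟨m⟩
  have h := sum_powerset_apply_card (fun i => f (i + 1)) (x := univ.erase m)
  rw [hc, Nat.sub_add_cancel hpos] at h
  rw [← h]
  refine sum_bij' (fun S _ => S.erase m) (fun T _ => insert m T) ?_ ?_ ?_ ?_ ?_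
  · intro S _
    exact mem_powerset.2 (erase_subset_erase _ (subset_univ _))
  · intro T _
    simp
  · intro S hS
    exact insert_erase (mem_filter.1 hS).2
  · intro T hT
    exact erase_insert fun hm => notMem_erase m _ (mem_powerset.1 hT hm)
  · intro S hS
    rw [card_erase_add_one (mem_filter.1 hS).2]

section ParentFunctions

variable {α β : Type*}

/-- `Ancestor p a b`: `a` is a strict ancestor of `b` for the parent function `p`. -/
def Ancestor (p : α → Option α) : α → α → Prop :=
  Relation.TransGen fun x y => p y = some x

theorem Ancestor.map {p : α → Option α} {q : β → Option β} (f : α → β)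
    (h : ∀ x y, p x = some y → q (f x) = some (f y)) {a b : α} (hab : Ancestor p a b) :
    Ancestor q (f a) (f b) := by
  induction hab with
  | single h' => exact Relation.TransGen.single (h _ _ h')
  | tail _ h' ih => exact Relation.TransGen.tail ih (h _ _ h')

theorem Ancestor.parent_eq_or {p : α → Option α} {a b : α} (h : Ancestor p a b) :
    ∃ c, p b = some c ∧ (a = c ∨ Ancestor p a c) := by
  rcases Relation.TransGen.tail'_iff.1 h with ⟨c, hac, hcb⟩
  refine ⟨c, hcb, ?_⟩
  rcases Relation.reflTransGen_iff_eq_or_transGen.1 hac with h | h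
  · exact Or.inl h.symm
  · exact Or.inr h

theorem Ancestor.depth_lt {p : α → Option α} {d : α → ℕ}
    (hd : ∀ v w, p v = some w → d w < d v) {a b : α} (h : Ancestor p a b) : d a < d b := by
  induction h with
  | single h => exact hd _ _ h
  | tail _ h ih => exact ih.trans (hd _ _ h)

/-- A property closed under taking parents is inherited by all ancestors. -/
theorem Ancestor.of_parent {p : α → Option α} {P : α → Prop}
    (hP : ∀ x y, P x → p x = some y → P y) {a b : α} (h : Ancestor p a b) (hb : P b) : P a := by
  induction h using Relation.TransGen.head_induction_on with
  | single h => exact hP _ _ hb h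
  | head h _ ih => exact hP _ _ ih h

/-- Rooted forests in which every downward chain of three vertices is either decreasing or
starts with its minimum; equivalently, forests avoiding 213, 312 and 231. -/
def GoodForest [LinearOrder α] (p : α → Option α) : Prop :=
  (∃ d : α → ℕ, ∀ v w, p v = some w → d w < d v) ∧
  ∀ a b c, Ancestor p a b → Ancestor p b c → (a < b ∧ a < c) ∨ (c < b ∧ b < a)

theorem GoodForest.of_map [LinearOrder α] [LinearOrder β] {p : α → Option α} {q : β → Option β}
    (f : α → β) (hf : StrictMono f) (h : ∀ x y, p x = some y → q (f x) = some (f y))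
    (hq : GoodForest q) : GoodForest p := by
  obtain ⟨⟨d, hd⟩, hq⟩ := hq
  refine ⟨⟨d ∘ f, fun v w hvw => hd _ _ (h _ _ hvw)⟩, fun a b c hab hbc => ?_⟩
  simpa only [hf.lt_iff_lt] using hq _ _ _ (hab.map f h) (hbc.map f h)

theorem card_goodForest_congr [LinearOrder α] [LinearOrder β] (e : α ≃o β) :
    Nat.card {p : α → Option α // GoodForest p} =
      Nat.card {p : β → Option β // GoodForest p} := by
  refine Nat.card_congr (Equiv.subtypeEquiv
    (Equiv.arrowCongr e.toEquiv (Equiv.optionCongr e.toEquiv)) fun p => ?_)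
  constructor
  · refine GoodForest.of_map e.symm e.symm.strictMono fun x y h => ?_
    rcases hp : p (e.symm x) with _ | z
    · simp [hp] at h
    · simp [hp] at h
      simp [← h]
  · refine GoodForest.of_map e e.strictMono fun x y h => ?_
    simp [h]

theorem card_goodForest_finset [LinearOrder α] (A : Finset α) :
    Nat.card {p : A → Option A // GoodForest p} =
      Nat.card {p : Fin A.card → Option (Fin A.card) // GoodForest p} :=
  card_goodForest_congr (A.orderIsoOfFin rfl).symm

/-- The forest induced on `A`: vertices whose parent is outside `A` become roots. -/
def restrictParent [DecidableEq α] (A : Finset α) (p : α → Option α) (x : A) : Option A :=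
  (p x).bind fun y => if h : y ∈ A then some ⟨y, h⟩ else none

theorem restrictParent_eq_some [DecidableEq α] {A : Finset α} {p : α → Option α} {x y : A} :
    restrictParent A p x = some y ↔ p x = some y.1 := by
  unfold restrictParent
  rcases p x with _ | z
  · simp
  · by_cases hz : z ∈ A
    · simp [hz, Subtype.ext_iff]
    · simp only [Option.bind_some, hz, dite_false, reduceCtorEq, Option.some.injEq, false_iff]
      rintro rfl
      exact hz y.2

theorem GoodForest.restrictParent [LinearOrder α] {p : α → Option α} (hp : GoodForest p)
    (A : Finset α) : GoodForest (restrictParent A p) :=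
  GoodForest.of_map Subtype.val (fun _ _ h => h) (fun _ _ => restrictParent_eq_some.1) hp

/-- If parents leaving `A` are roots, ancestry inside `A` is that of the induced forest. -/
theorem Ancestor.restrictParent [DecidableEq α] {A : Finset α} {p : α → Option α}
    (hA : ∀ x ∈ A, ∀ y, p x = some y → y ∉ A → p y = none) {a b : α} (h : Ancestor p a b)
    (ha : a ∈ A) (hb : b ∈ A) : Ancestor (restrictParent A p) ⟨a, ha⟩ ⟨b, hb⟩ := by
  induction h with
  | single h => exact Relation.TransGen.single (restrictParent_eq_some.2 h)
  | @tail y c hay hyc ih =>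
    have hy : y ∈ A := by
      by_contra hy
      obtain ⟨z, hz, -⟩ := Ancestor.parent_eq_or hay
      simp [hA c hb y hyc hy] at hz
    exact (ih hy).tail (restrictParent_eq_some.2 hyc)

/-- `S` is the vertex set of a connected component of `p`, with root `r`. -/
def IsComponent (p : α → Option α) (S : Finset α) (r : α) : Prop :=
  r ∈ S ∧ p r = none ∧ (∀ x ∈ S, x ≠ r → ∃ y ∈ S, p x = some y) ∧
    ∀ x ∉ S, ∀ y, p x = some y → y ∉ S

theorem IsComponent.ancestor {p : α → Option α} {S : Finset α} {r : α} (h : IsComponent p S r)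
    {d : α → ℕ} (hd : ∀ v w, p v = some w → d w < d v) {x : α} (hx : x ∈ S) (hxr : x ≠ r) :
    Ancestor p r x := by
  induction hn : d x using Nat.strong_induction_on generalizing x with
  | _ n ih =>
    obtain ⟨y, hy, hxy⟩ := h.2.2.1 x hx hxr
    by_cases hyr : y = r
    · exact Relation.TransGen.single (hyr ▸ hxy)
    · exact (ih (d y) (hn ▸ hd _ _ hxy) hy hyr rfl).tail hxy

theorem IsComponent.mem_iff {p : α → Option α} {S : Finset α} {r : α} (h : IsComponent p S r)
    {d : α → ℕ} (hd : ∀ v w, p v = some w → d w < d v) {x : α} :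
    x ∈ S ↔ x = r ∨ Ancestor p r x := by
  constructor
  · intro hx
    by_cases hxr : x = r
    · exact Or.inl hxr
    · exact Or.inr (h.ancestor hd hx hxr)
  · rintro (rfl | hx)
    · exact h.1
    · by_contra hxS
      exact hx.of_parent (P := fun x => x ∉ S) (fun x y hx hxy => h.2.2.2 x hx y hxy) hxS h.1

theorem IsComponent.root_unique {p : α → Option α} {S S' : Finset α} {r r' : α}
    (h : IsComponent p S r) (h' : IsComponent p S' r')
    {d : α → ℕ} (hd : ∀ v w, p v = some w → d w < d v) {x : α} (hx : x ∈ S) (hx' : x ∈ S') :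
    r = r' := by
  induction hn : d x using Nat.strong_induction_on generalizing x with
  | _ n ih =>
    by_cases hxr : x = r
    · by_cases hxr' : x = r'
      · exact hxr.symm.trans hxr'
      · obtain ⟨y, -, hy⟩ := h'.2.2.1 x hx' hxr'
        simp [hxr, h.2.1] at hy
    · obtain ⟨y, hyS, hy⟩ := h.2.2.1 x hx hxr
      by_cases hxr' : x = r'
      · simp [hxr', h'.2.1] at hy
      · obtain ⟨z, hzS, hz⟩ := h'.2.2.1 x hx' hxr'
        obtain rfl : y = z := by simpa [hy] using hz
        exact ih (d y) (hn ▸ hd _ _ hy) hyS hzS rfl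

theorem exists_isComponent [Fintype α] {p : α → Option α}
    {d : α → ℕ} (hd : ∀ v w, p v = some w → d w < d v) (m : α) :
    ∃ S r, m ∈ S ∧ IsComponent p S r := by
  classical
  have hroot : ∃ r, p r = none ∧ (m = r ∨ Ancestor p r m) := by
    induction hn : d m using Nat.strong_induction_on generalizing m with
    | _ n ih =>
      rcases hm : p m with _ | y
      · exact ⟨m, hm, Or.inl rfl⟩
      · obtain ⟨r, hr, hyr⟩ := ih (d y) (hn ▸ hd _ _ hm) y rfl
        refine ⟨r, hr, Or.inr ?_⟩
        rcases hyr with rfl | hyr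
        · exact Relation.TransGen.single hm
        · exact hyr.tail hm
  obtain ⟨r, hr, hmr⟩ := hroot
  refine ⟨Finset.univ.filter fun x => x = r ∨ Ancestor p r x, r,
    by simpa using hmr, by simp, hr, ?_, ?_⟩
  · intro x hx hxr
    simp only [Finset.mem_filter, Finset.mem_univ, true_and, hxr, false_or] at hx
    obtain ⟨y, hy, hry⟩ := hx.parent_eq_or
    refine ⟨y, ?_, hy⟩
    simpa [eq_comm] using hry
  · intro x hx y hxy hy
    simp only [Finset.mem_filter, Finset.mem_univ, true_and, not_or] at hx hy
    rcases hy with rfl | hy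
    · exact hx.2 (Relation.TransGen.single hxy)
    · exact hx.2 (hy.tail hxy)

end ParentFunctions

section Decomposition

variable {α : Type*} [LinearOrder α] {S : Finset α} {r : α}

/-- In a good forest, the labels below the root of a component decrease along paths, and
those above it stay above. -/
theorem GoodForest.parent_bounds {p : α → Option α} (hp : GoodForest p) (h : IsComponent p S r)
    {x y : α} (hx : x ∈ S) (hxy : p x = some y) :
    (x < r → x < y ∧ y ≤ r) ∧ (r < x → r ≤ y) := by
  obtain ⟨⟨d, hd⟩, hp⟩ := hp
  have hxr : x ≠ r := by
    rintro rfl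
    simp [h.2.1] at hxy
  have hyS : y ∈ S := by
    obtain ⟨z, hz, hxz⟩ := h.2.2.1 x hx hxr
    obtain rfl : y = z := by simpa [hxy] using hxz
    exact hz
  by_cases hyr : y = r
  · subst hyr
    exact ⟨fun h => ⟨h, le_rfl⟩, fun _ => le_rfl⟩
  · rcases hp r y x (h.ancestor hd hyS hyr) (Relation.TransGen.single hxy) with h1 | h1
    · exact ⟨fun h => absurd h h1.2.not_gt, fun _ => h1.1.le⟩
    · exact ⟨fun _ => ⟨h1.1, h1.2.le⟩, fun h => absurd (h1.1.trans h1.2) h.not_gt⟩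

theorem goodForest_of_restrictParent [Fintype α] {p : α → Option α} (h : IsComponent p S r)
    (hlt : ∀ x ∈ S, ∀ y, p x = some y → x < r → x < y ∧ y ≤ r)
    (hgt : ∀ x ∈ S, ∀ y, p x = some y → r < x → r ≤ y)
    (hC : GoodForest (restrictParent {x ∈ S | r < x} p))
    (hE : GoodForest (restrictParent Sᶜ p)) : GoodForest p := by
  obtain ⟨⟨dC, hdC⟩, hC⟩ := hC
  obtain ⟨⟨dE, hdE⟩, hE⟩ := hE
  obtain ⟨-, hr, hS, hSc⟩ := h
  have hS' : ∀ x ∈ S, ∀ y, p x = some y → y ∈ S := by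
    intro x hx y hxy
    obtain ⟨z, hz, hxz⟩ := hS x hx (by rintro rfl; simp [hr] at hxy)
    obtain rfl : y = z := by simpa [hxy] using hxz
    exact hz
  have hmC : ∀ {x}, x ∈ S → r < x → x ∈ ({x ∈ S | r < x} : Finset α) := by
    intro x hx hrx
    simp [hx, hrx]
  have hmE : ∀ {x}, x ∉ S → x ∈ Sᶜ := by simp
  have hCr : ∀ x ∈ ({x ∈ S | r < x} : Finset α), ∀ y, p x = some y →
      y ∉ ({x ∈ S | r < x} : Finset α) → p y = none := by
    intro x hx y hxy hy
    rw [Finset.mem_filter] at hx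
    have h1 := hS' x hx.1 y hxy
    have h2 := hgt x hx.1 y hxy hx.2
    rcases h2.eq_or_lt with rfl | h2
    · exact hr
    · exact absurd (hmC h1 h2) hy
  have hEr : ∀ x ∈ Sᶜ, ∀ y, p x = some y → y ∉ Sᶜ → p y = none := by
    intro x hx y hxy hy
    exact absurd (hmE (hSc x (by simpa using hx) y hxy)) hy
  constructor
  · refine ⟨fun x => if hx : x ∈ S then if hrx : r < x then dC ⟨x, hmC hx hrx⟩ + 1
      else (Finset.univ.filter fun z => x < z ∧ z ≤ r).card else dE ⟨x, hmE hx⟩, ?_⟩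
    intro x y hxy
    by_cases hx : x ∈ S
    · have hy := hS' x hx y hxy
      simp only [hx, hy, dite_true]
      rcases lt_trichotomy x r with hxr | rfl | hxr
      · obtain ⟨h1, h2⟩ := hlt x hx y hxy hxr
        rw [dif_neg h2.not_gt, dif_neg hxr.not_gt]
        refine Finset.card_lt_card (Finset.ssubset_iff_of_subset ?_ |>.2 ⟨y, ?_, ?_⟩)
        · intro z hz
          simp only [Finset.mem_filter, Finset.mem_univ, true_and] at hz ⊢
          exact ⟨h1.trans hz.1, hz.2⟩
        · simp [h1, h2]
        · simp
      · simp [hr] at hxy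
      · rw [dif_pos hxr]
        rcases (hgt x hx y hxy hxr).eq_or_lt with rfl | h2
        · have : (Finset.univ.filter fun z => r < z ∧ z ≤ r) = ∅ := by
            ext z
            simp
          simp [this]
        · rw [dif_pos h2]
          exact Nat.succ_lt_succ (hdC _ _ (restrictParent_eq_some.2 hxy))
    · have hy := hSc x hx y hxy
      simp only [hx, hy, dite_false]
      exact hdE _ _ (restrictParent_eq_some.2 hxy)
  · intro a b c hab hbc
    by_cases hc : c ∈ S
    · have hb : b ∈ S := hbc.of_parent (P := (· ∈ S)) (fun x y hx => hS' x hx y) hc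
      have ha : a ∈ S := hab.of_parent (P := (· ∈ S)) (fun x y hx => hS' x hx y) hb
      have key : ∀ {u v}, Ancestor p u v → v ∈ S → v < r → v < u := by
        intro u v huv
        induction huv with
        | single h => exact fun hv hvr => (hlt _ hv _ h hvr).1
        | @tail y z huy hyz ih =>
          intro hz hzr
          obtain ⟨h1, h2⟩ := hlt _ hz _ hyz hzr
          have hyr : y ≠ r := by
            rintro rfl
            obtain ⟨w, hw, -⟩ := Ancestor.parent_eq_or huy
            simp [hr] at hw
          exact h1.trans (ih (hS' _ hz _ hyz) (h2.lt_of_ne hyr))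
      have hnr : ∀ {u v}, Ancestor p u v → v ≠ r := by
        rintro u _ huv rfl
        obtain ⟨w, hw, -⟩ := huv.parent_eq_or
        simp [hr] at hw
      have hbr := hnr hab
      have hup : ∀ x y, (x ∈ S ∧ r ≤ x) → p x = some y → (y ∈ S ∧ r ≤ y) := by
        rintro x y ⟨hx, hrx⟩ hxy
        refine ⟨hS' x hx y hxy, hgt x hx y hxy (hrx.lt_of_ne ?_)⟩
        rintro rfl
        simp [hr] at hxy
      have hdn : ∀ x y, (x ∈ S ∧ x ≤ r) → p x = some y → (y ∈ S ∧ y ≤ r) := by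
        rintro x y ⟨hx, hrx⟩ hxy
        refine ⟨hS' x hx y hxy, (hlt x hx y hxy (hrx.lt_of_ne ?_)).2⟩
        rintro rfl
        simp [hr] at hxy
      rcases (hnr hbc).lt_or_gt with hcr | hcr
      · have hb' := (hbc.of_parent hdn ⟨hc, hcr.le⟩).2.lt_of_ne hbr
        exact Or.inr ⟨key hbc hc hcr, key hab hb hb'⟩
      · have hb' := (hbc.of_parent hup ⟨hc, hcr.le⟩).2.lt_of_ne' hbr
        rcases (hab.of_parent hup ⟨hb, hb'.le⟩).2.eq_or_lt with rfl | ha'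
        · exact Or.inl ⟨hb', hcr⟩
        · exact hC _ _ _ (hab.restrictParent hCr (hmC ha ha') (hmC hb hb'))
            (hbc.restrictParent hCr (hmC hb hb') (hmC hc hcr))
    · have hb : b ∉ S := hbc.of_parent (P := (· ∉ S)) (fun x y hx => hSc x hx y) hc
      have ha : a ∉ S := hab.of_parent (P := (· ∉ S)) (fun x y hx => hSc x hx y) hb
      exact hE _ _ _ (hab.restrictParent hEr (hmE ha) (hmE hb))
        (hbc.restrictParent hEr (hmE hb) (hmE hc))

/-- Assemble a forest having `S` as a component with root `r` from the parents `f` of the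
vertices of `S` below `r`, a forest `g` on the vertices of `S` above `r`, and a forest `h`
outside `S`. -/
def mergeForest [Fintype α]
    (f : ∀ x : ({x ∈ S | x < r} : Finset α), ({y ∈ S | x < y ∧ y ≤ r} : Finset α))
    (g : ({x ∈ S | r < x} : Finset α) → Option ({x ∈ S | r < x} : Finset α))
    (h : (Sᶜ : Finset α) → Option (Sᶜ : Finset α)) (x : α) : Option α :=
  if hx : x ∈ S then
    if hxr : x < r then some (f ⟨x, Finset.mem_filter.2 ⟨hx, hxr⟩⟩)
    else if hrx : r < x then
      some ((g ⟨x, Finset.mem_filter.2 ⟨hx, hrx⟩⟩).elim r Subtype.val)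
    else none
  else (h ⟨x, Finset.mem_compl.2 hx⟩).map Subtype.val

section Merge

variable [Fintype α]
    (f : ∀ x : ({x ∈ S | x < r} : Finset α), ({y ∈ S | x < y ∧ y ≤ r} : Finset α))
    (g : ({x ∈ S | r < x} : Finset α) → Option ({x ∈ S | r < x} : Finset α))
    (h : (Sᶜ : Finset α) → Option (Sᶜ : Finset α))

theorem mergeForest_of_lt (x : ({x ∈ S | x < r} : Finset α)) :
    mergeForest f g h x = some (f x).1 := by
  obtain ⟨x, hx⟩ := x
  have hx' := Finset.mem_filter.1 hx
  simp [mergeForest, hx'.1, hx'.2]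

theorem mergeForest_of_gt (x : ({x ∈ S | r < x} : Finset α)) :
    mergeForest f g h x = some ((g x).elim r Subtype.val) := by
  obtain ⟨x, hx⟩ := x
  have hx' := Finset.mem_filter.1 hx
  simp [mergeForest, hx'.1, hx'.2, hx'.2.not_gt]

theorem mergeForest_of_notMem (x : (Sᶜ : Finset α)) :
    mergeForest f g h x = (h x).map Subtype.val := by
  obtain ⟨x, hx⟩ := x
  have hx' := Finset.mem_compl.1 hx
  simp [mergeForest, hx']

theorem mergeForest_root (hr : r ∈ S) : mergeForest f g h r = none := by
  simp [mergeForest, hr]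

theorem restrictParent_mergeForest_gt :
    restrictParent {x ∈ S | r < x} (mergeForest f g h) = g := by
  funext x
  refine Option.ext fun y => ?_
  rw [restrictParent_eq_some, mergeForest_of_gt]
  rcases g x with _ | z
  · have := (Finset.mem_filter.1 y.2).2.ne
    simpa only [Option.elim_none, Option.some.injEq, reduceCtorEq, iff_false] using this
  · simp only [Option.elim_some, Option.some.injEq, Subtype.ext_iff]

theorem restrictParent_mergeForest_compl :
    restrictParent Sᶜ (mergeForest f g h) = h := by
  funext x
  refine Option.ext fun y => ?_
  rw [restrictParent_eq_some, mergeForest_of_notMem]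
  rcases h x with _ | z
  · simp only [Option.map_none, reduceCtorEq]
  · simp only [Option.map_some, Option.some.injEq, Subtype.ext_iff]

end Merge

theorem isComponent_mergeForest [Fintype α]
    (f : ∀ x : ({x ∈ S | x < r} : Finset α), ({y ∈ S | x < y ∧ y ≤ r} : Finset α))
    (g : ({x ∈ S | r < x} : Finset α) → Option ({x ∈ S | r < x} : Finset α))
    (h : (Sᶜ : Finset α) → Option (Sᶜ : Finset α)) (hr : r ∈ S) :
    IsComponent (mergeForest f g h) S r := by
  refine ⟨hr, mergeForest_root f g h hr, fun x hx hxr => ?_, fun x hx y hxy => ?_⟩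
  · rcases lt_or_gt_of_ne hxr with hxr | hxr
    · have hx' : x ∈ ({x ∈ S | x < r} : Finset α) := Finset.mem_filter.2 ⟨hx, hxr⟩
      exact ⟨_, (Finset.mem_filter.1 (f ⟨x, hx'⟩).2).1, mergeForest_of_lt f g h ⟨x, hx'⟩⟩
    · have hx' : x ∈ ({x ∈ S | r < x} : Finset α) := Finset.mem_filter.2 ⟨hx, hxr⟩
      refine ⟨_, ?_, mergeForest_of_gt f g h ⟨x, hx'⟩⟩
      rcases g ⟨x, hx'⟩ with _ | z
      · exact hr
      · exact (Finset.mem_filter.1 z.2).1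
  · rw [mergeForest_of_notMem f g h ⟨x, Finset.mem_compl.2 hx⟩, Option.map_eq_some_iff] at hxy
    obtain ⟨z, -, rfl⟩ := hxy
    exact Finset.mem_compl.1 z.2

theorem goodForest_mergeForest [Fintype α]
    (f : ∀ x : ({x ∈ S | x < r} : Finset α), ({y ∈ S | x < y ∧ y ≤ r} : Finset α))
    (g : ({x ∈ S | r < x} : Finset α) → Option ({x ∈ S | r < x} : Finset α))
    (h : (Sᶜ : Finset α) → Option (Sᶜ : Finset α)) (hr : r ∈ S)
    (hg : GoodForest g) (hh : GoodForest h) : GoodForest (mergeForest f g h) := by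
  refine goodForest_of_restrictParent (isComponent_mergeForest f g h hr) ?_ ?_ ?_ ?_
  · intro x hx y hxy hxr
    rw [mergeForest_of_lt f g h ⟨x, Finset.mem_filter.2 ⟨hx, hxr⟩⟩, Option.some.injEq] at hxy
    subst hxy
    exact (Finset.mem_filter.1 (f ⟨x, _⟩).2).2
  · intro x hx y hxy hxr
    have hx' : x ∈ ({x ∈ S | r < x} : Finset α) := Finset.mem_filter.2 ⟨hx, hxr⟩
    rw [mergeForest_of_gt f g h ⟨x, hx'⟩, Option.some.injEq] at hxy
    subst hxy
    rcases g ⟨x, hx'⟩ with _ | z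
    · exact le_rfl
    · exact (Finset.mem_filter.1 z.2).2.le
  · rwa [restrictParent_mergeForest_gt]
  · rwa [restrictParent_mergeForest_compl]

theorem mergeForest_restrictParent [Fintype α] {p : α → Option α} (hp : IsComponent p S r)
    (hgt : ∀ x ∈ S, ∀ y, p x = some y → r < x → r ≤ y)
    (f : ∀ x : ({x ∈ S | x < r} : Finset α), ({y ∈ S | x < y ∧ y ≤ r} : Finset α))
    (hf : ∀ x, p x.1 = some (f x).1) :
    mergeForest f (restrictParent {x ∈ S | r < x} p) (restrictParent Sᶜ p) = p := by
  obtain ⟨hrS, hr, hS, hSc⟩ := hp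
  funext x
  by_cases hx : x ∈ S
  · rcases lt_trichotomy x r with hxr | rfl | hxr
    · have hx' : x ∈ ({x ∈ S | x < r} : Finset α) := Finset.mem_filter.2 ⟨hx, hxr⟩
      exact (mergeForest_of_lt _ _ _ ⟨x, hx'⟩).trans (hf ⟨x, hx'⟩).symm
    · rw [mergeForest_root _ _ _ hrS, hr]
    · have hx' : x ∈ ({x ∈ S | r < x} : Finset α) := Finset.mem_filter.2 ⟨hx, hxr⟩
      rw [mergeForest_of_gt _ _ _ ⟨x, hx'⟩]
      obtain ⟨y, hy, hxy⟩ := hS x hx hxr.ne'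
      rw [hxy]
      congr 1
      rcases (hgt x hx y hxy hxr).eq_or_lt with rfl | hy'
      · simp [restrictParent, hxy]
      · simp [restrictParent, hxy, hy, hy']
  · rw [mergeForest_of_notMem _ _ _ ⟨x, Finset.mem_compl.2 hx⟩]
    rcases hxy : p x with _ | y
    · simp [restrictParent, hxy]
    · simp [restrictParent, hxy, hSc x hx y hxy]

open Finset in
theorem prod_card_parents_below (hr : r ∈ S) :
    ∏ x : ({x ∈ S | x < r} : Finset α), #{y ∈ S | x.1 < y ∧ y ≤ r} =
      (#{x ∈ S | x < r}).factorial := by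
  rw [← prod_card_filter_le, prod_coe_sort _ fun x => #{y ∈ S | x < y ∧ y ≤ r}]
  refine prod_congr rfl fun x hx => ?_
  rw [mem_filter] at hx
  have h1 : insert x {y ∈ S | x < y ∧ y ≤ r} =
      insert r {y ∈ ({x ∈ S | x < r} : Finset α) | x ≤ y} := by
    ext y
    simp only [mem_insert, mem_filter]
    constructor
    · rintro (rfl | ⟨h1, h2, h3⟩)
      · exact Or.inr ⟨hx, le_rfl⟩
      · exact h3.eq_or_lt.imp id fun h => ⟨⟨h1, h⟩, h2.le⟩
    · rintro (rfl | ⟨⟨h1, h2⟩, h3⟩)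
      · exact Or.inr ⟨hr, hx.2, le_rfl⟩
      · exact h3.eq_or_lt.imp Eq.symm fun h => ⟨h1, h, h2.le⟩
  have h2 := congrArg card h1
  rwa [card_insert_of_notMem (by simp), card_insert_of_notMem (by simp),
    Nat.add_right_cancel_iff] at h2

open Finset in
theorem card_goodForest_isComponent [Fintype α] (hr : r ∈ S) :
    Nat.card {p : α → Option α // GoodForest p ∧ IsComponent p S r} =
      (#{x ∈ S | x < r}).factorial *
        (Nat.card {g : ({x ∈ S | r < x} : Finset α) → Option ({x ∈ S | r < x} : Finset α) //
          GoodForest g} *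
        Nat.card {h : (Sᶜ : Finset α) → Option (Sᶜ : Finset α) // GoodForest h}) := by
  rw [← prod_card_parents_below hr]
  have hcard : ∏ x : ({x ∈ S | x < r} : Finset α), #{y ∈ S | x.1 < y ∧ y ≤ r} = Nat.card
      (∀ x : ({x ∈ S | x < r} : Finset α), ({y ∈ S | x < y ∧ y ≤ r} : Finset α)) := by
    rw [Nat.card_pi]
    simp only [Nat.card_eq_fintype_card, Fintype.card_coe]
  rw [hcard, ← Nat.card_prod, ← Nat.card_prod]
  symm
  refine Nat.card_congr (Equiv.ofBijective (fun t => ⟨mergeForest t.1 t.2.1.1 t.2.2.1,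
    goodForest_mergeForest _ _ _ hr t.2.1.2 t.2.2.2, isComponent_mergeForest _ _ _ hr⟩) ⟨?_, ?_⟩)
  · rintro ⟨f, ⟨g, hg⟩, ⟨h, hh⟩⟩ ⟨f', ⟨g', hg'⟩, ⟨h', hh'⟩⟩ heq
    have heq : mergeForest f g h = mergeForest f' g' h' := congrArg Subtype.val heq
    have h1 : g = g' := by
      rw [← restrictParent_mergeForest_gt f g h, heq, restrictParent_mergeForest_gt]
    have h2 : h = h' := by
      rw [← restrictParent_mergeForest_compl f g h, heq, restrictParent_mergeForest_compl]
    have h3 : f = f' := by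
      funext x
      have := congrFun heq x
      rw [mergeForest_of_lt, mergeForest_of_lt, Option.some.injEq] at this
      exact Subtype.ext this
    subst h1 h2 h3
    rfl
  · rintro ⟨p, hp, hc⟩
    have hf : ∀ x : ({x ∈ S | x < r} : Finset α),
        ∃ y : ({y ∈ S | x < y ∧ y ≤ r} : Finset α), p x = some y.1 := by
      rintro ⟨x, hx⟩
      obtain ⟨hx, hxr⟩ := mem_filter.1 hx
      obtain ⟨y, hy, hxy⟩ := hc.2.2.1 x hx hxr.ne
      exact ⟨⟨y, mem_filter.2 ⟨hy, (hp.parent_bounds hc hx hxy).1 hxr⟩⟩, hxy⟩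
    choose f hf using hf
    exact ⟨⟨f, ⟨_, hp.restrictParent _⟩, ⟨_, hp.restrictParent _⟩⟩, Subtype.ext
      (mergeForest_restrictParent hc (fun x hx y hxy => (hp.parent_bounds hc hx hxy).2) f hf)⟩

open Finset in
/-- Good forests are classified by the vertex set and the root of the component of `m`. -/
theorem card_goodForest_eq_sum_isComponent [Fintype α] (m : α) :
    Nat.card {p : α → Option α // GoodForest p} =
      ∑ S : Finset α with m ∈ S, ∑ r ∈ S,
        Nat.card {p : α → Option α // GoodForest p ∧ IsComponent p S r} := by
  classical
  simp only [Nat.card_eq_fintype_card, Fintype.card_subtype]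
  rw [sum_sigma' _ _ fun S r => #{p : α → Option α | GoodForest p ∧ IsComponent p S r},
    ← card_biUnion]
  · congr 1
    ext p
    simp only [mem_filter, mem_univ, true_and, mem_biUnion, mem_sigma, Sigma.exists]
    constructor
    · intro hp
      obtain ⟨d, hd⟩ := hp.1
      obtain ⟨S, r, hm, h⟩ := exists_isComponent hd m
      exact ⟨S, r, ⟨hm, h.1⟩, hp, h⟩
    · rintro ⟨S, r, -, hp, -⟩
      exact hp
  · rintro ⟨S, r⟩ hx ⟨S', r'⟩ hx' hne
    refine disjoint_left.2 fun p hp hp' => ?_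
    simp only [mem_filter, mem_univ, true_and, mem_sigma, mem_coe] at hx hx' hp hp'
    obtain ⟨d, hd⟩ := hp.1.1
    obtain rfl := hp.2.root_unique hp'.2 hd hx.1 hx'.1
    refine hne ?_
    obtain rfl : S = S' := by
      ext x
      rw [hp.2.mem_iff hd, hp'.2.mem_iff hd]
    rfl

end Decomposition

/-- The number of good forests on `Fin n`. -/
noncomputable def numGoodForests (n : ℕ) : ℕ :=
  Nat.card {p : Fin n → Option (Fin n) // GoodForest p}

open Finset in
theorem numGoodForests_eq_sum_range {n : ℕ} (hn : 0 < n) :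
    numGoodForests n = ∑ k ∈ range n, ∑ r ∈ range (k + 1),
      (n - 1).choose k * r.factorial * numGoodForests (n - (k + 1)) *
        numGoodForests (k - r) := by
  unfold numGoodForests
  rw [card_goodForest_eq_sum_isComponent (⟨0, hn⟩ : Fin n)]
  simp only [← numGoodForests.eq_1]
  have hterm : ∀ S : Finset (Fin n), ∑ r ∈ S, Nat.card
      {p : Fin n → Option (Fin n) // GoodForest p ∧ IsComponent p S r} =
      ∑ i ∈ range #S, i.factorial * (numGoodForests (#S - 1 - i) * numGoodForests (n - #S)) := by
    intro S
    rw [← sum_card_filter_lt S fun i =>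
      i.factorial * (numGoodForests (#S - 1 - i) * numGoodForests (n - #S))]
    refine sum_congr rfl fun r hr => ?_
    have hgt : #{x ∈ S | r < x} = #S - 1 - #{x ∈ S | x < r} := by
      have h1 : ({x ∈ S | ¬ x < r} : Finset (Fin n)) = insert r {x ∈ S | r < x} := by
        ext x
        simp only [mem_insert, mem_filter, not_lt, le_iff_eq_or_lt]
        constructor
        · rintro ⟨h1, h2⟩
          exact h2.imp Eq.symm fun h => ⟨h1, h⟩
        · rintro (rfl | ⟨h1, h2⟩)
          · exact ⟨hr, Or.inl rfl⟩
          · exact ⟨h1, Or.inr h2⟩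
      have h2 := card_filter_add_card_filter_not (s := S) (fun x => x < r)
      rw [h1, card_insert_of_notMem (by simp)] at h2
      omega
    rw [card_goodForest_isComponent hr, card_goodForest_finset, card_goodForest_finset, hgt,
      card_compl, Fintype.card_fin]
    rfl
  simp only [hterm]
  rw [sum_filter_mem_apply_card (⟨0, hn⟩ : Fin n) fun k => ∑ i ∈ range k,
    i.factorial * (numGoodForests (k - 1 - i) * numGoodForests (n - k)), Fintype.card_fin]
  refine sum_congr rfl fun k _ => ?_
  rw [smul_eq_mul, mul_sum]
  refine sum_congr rfl fun i _ => ?_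
  rw [Nat.add_sub_cancel]
  ring

theorem forestContains_three_iff {n : ℕ} (p : Fin n → Option (Fin n)) (s t v : ℕ) :
    ForestContains p [s, t, v] ↔ ∃ a b c, Ancestor p a b ∧ Ancestor p b c ∧
      ((s < t ↔ a < b) ∧ (t < s ↔ b < a)) ∧ ((t < v ↔ b < c) ∧ (v < t ↔ c < b)) ∧
      ((s < v ↔ a < c) ∧ (v < s ↔ c < a)) := by
  constructor
  · rintro ⟨u, h1, h2⟩
    let i0 : Fin [s, t, v].length := ⟨0, by simp⟩
    let i1 : Fin [s, t, v].length := ⟨1, by simp⟩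
    let i2 : Fin [s, t, v].length := ⟨2, by simp⟩
    exact ⟨u i0, u i1, u i2, h1 i0 i1 (by simp [i0, i1]), h1 i1 i2 (Fin.mk_lt_mk.2 one_lt_two),
      ⟨h2 i0 i1, h2 i1 i0⟩, ⟨h2 i1 i2, h2 i2 i1⟩, ⟨h2 i0 i2, h2 i2 i0⟩⟩
  · rintro ⟨a, b, c, hab, hbc, h1, h2, h3⟩
    refine ⟨(![a, b, c] : Fin 3 → Fin n), ?_, ?_⟩
    · intro i j hij
      change Fin 3 at i j
      have hac : Ancestor p a c := Relation.TransGen.trans hab hbc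
      fin_cases i <;> fin_cases j <;> first
        | exact hab | exact hbc | exact hac | exact absurd hij (by simp +decide)
    · intro i j
      change Fin 3 at i j
      fin_cases i <;> fin_cases j <;> first
        | exact h1.1 | exact h1.2 | exact h2.1 | exact h2.2 | exact h3.1 | exact h3.2
        | exact iff_of_false (lt_irrefl _) (lt_irrefl _)

theorem isForest_and_avoids_iff_goodForest {n : ℕ} (p : Fin n → Option (Fin n)) :
    (IsForest p ∧ ForestAvoids p [2, 1, 3] ∧ ForestAvoids p [3, 1, 2] ∧
      ForestAvoids p [2, 3, 1]) ↔ GoodForest p := by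
  unfold ForestAvoids
  simp only [forestContains_three_iff]
  refine and_congr_right fun ⟨d, hd⟩ => ?_
  constructor
  · rintro ⟨h1, h2, h3⟩ a b c hab hbc
    have hne : ∀ {x y}, Ancestor p x y → x ≠ y := by
      rintro x _ h rfl
      exact lt_irrefl _ (h.depth_lt hd)
    have nab := hne hab
    have nbc := hne hbc
    have nac : a ≠ c := hne (Relation.TransGen.trans hab hbc)
    by_contra hcon
    have hpat : (b < a ∧ a < c) ∨ (b < c ∧ c < a) ∨ (c < a ∧ a < b) := by
      omega
    rcases hpat with h | h | h
    · exact h1 ⟨a, b, c, hab, hbc, by omega⟩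
    · exact h2 ⟨a, b, c, hab, hbc, by omega⟩
    · exact h3 ⟨a, b, c, hab, hbc, by omega⟩
  · intro h
    refine ⟨?_, ?_, ?_⟩ <;>
    · rintro ⟨a, b, c, hab, hbc, h'⟩
      have := h a b c hab hbc
      omega

theorem recurrence_forests_avoiding_213_312_231 (F : ℕ → ℕ)
    (hF : ∀ j : ℕ, F j = Nat.card {p : Fin j → Option (Fin j) //
        IsForest p ∧ ForestAvoids p [2, 1, 3] ∧ ForestAvoids p [3, 1, 2] ∧
        ForestAvoids p [2, 3, 1]}) :
    F 1 = 1 ∧ ∀ n : ℕ, 1 ≤ n →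
      F n = ∑ k ∈ Finset.Icc 1 n, ∑ r ∈ Finset.Icc 1 k,
        (n - 1).choose (k - 1) * (r - 1).factorial * F (n - k) * F (k - r) := by
  have hFG : F = numGoodForests := by
    funext j
    simp only [hF, isForest_and_avoids_iff_goodForest, numGoodForests]
  subst hFG
  have hIcc : ∀ (f : ℕ → ℕ) (n : ℕ),
      ∑ k ∈ Finset.Icc 1 n, f k = ∑ k ∈ Finset.range n, f (k + 1) := by
    intro f n
    induction n with
    | zero => simp
    | succ n ih => rw [Finset.sum_Icc_succ_top (by omega), ih, Finset.sum_range_succ]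
  have hrec : ∀ n : ℕ, 1 ≤ n → numGoodForests n =
      ∑ k ∈ Finset.Icc 1 n, ∑ r ∈ Finset.Icc 1 k, (n - 1).choose (k - 1) *
        (r - 1).factorial * numGoodForests (n - k) * numGoodForests (k - r) := by
    intro n hn
    rw [numGoodForests_eq_sum_range hn, hIcc]
    refine Finset.sum_congr rfl fun k _ => ?_
    rw [hIcc]
    simp
  have h0 : numGoodForests 0 = 1 := by
    unfold numGoodForests
    rw [Nat.card_eq_one_iff_unique]
    exact ⟨inferInstance, ⟨⟨fun x => x.elim0, ⟨fun x => x.elim0, fun x => x.elim0⟩,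
      fun x => x.elim0⟩⟩⟩
  refine ⟨?_, hrec⟩
  rw [hrec 1 le_rfl]
  simp [h0]
end
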